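/- Suppose h > 0 is such that for every δ > 0 there exists R > 0 with |∇A(x)|² ≤ (h + δ) a(x) A(x) for all |x| ≥ R. Then for every ε > 0 and every integer k ≥ 0 there exist constants β > 0, c₀ ≥ 0, t₀ > 0 and C > 0 (with C depending on N, k, R₀, ε) such that, writing Ã := A + c₀, every smooth classical solution u of the damped wave equation satisfies for all t ≥ 0: ∫_Ω Φ_{Ã,β}(x,t) a(x) |∂_t^k u(x,t)|² dx ≤ C (t₀+t)^{−1/h − 2k + ε} ‖(u₀,u₁)‖²_{H^{k+1}×H^k} and ∫_Ω Φ_{Ã,β}(x,t) |∇_x ∂_t^k u(x,t)|² dx ≤ C (t₀+t)^{−1/h − 2k − 1 + ε} ‖(u₀,u₁)‖²_{H^{k+1}×H^k}, where ‖(u₀,u₁)‖²_{H^{k+1}×H^k} := Σ_{|γ|≤k+1} ∫_Ω |∂^γ u₀|² dx + Σ_{|γ|≤k} ∫_Ω |∂^γ u₁|² dx. -/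

import Mathlib

open MeasureTheory Real

/-- The Laplacian of `f : ℝ^N → ℝ`, as the sum of the second partial derivatives. -/
noncomputable def lap {N : ℕ} (f : EuclideanSpace ℝ (Fin N) → ℝ)
    (x : EuclideanSpace ℝ (Fin N)) : ℝ :=
  ∑ i : Fin N, fderiv ℝ (fun y => fderiv ℝ f y (EuclideanSpace.single i 1)) x
    (EuclideanSpace.single i 1)

section

open Filter Topology Set

section Divergence

variable {E : Type*} [NormedAddCommGroup E] [NormedSpace ℝ E]

/-- The simple zeros of a real function form a countable set. -/
lemma countable_zero_hasDerivAt_ne {g g' : ℝ → ℝ} (hg : ∀ s, HasDerivAt g (g' s) s) :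
    {s | g s = 0 ∧ g' s ≠ 0}.Countable := by
  set S := {s | g s = 0 ∧ g' s ≠ 0} with hS
  have : DiscreteTopology S := by
    rw [discreteTopology_subtype_iff]
    intro s hs
    have h1 := (hg s).eventually_ne (c := 0) hs.2
    rw [← Filter.empty_mem_iff_bot, Filter.mem_inf_principal]
    filter_upwards [h1] with z hz hzS
    exact (hz hzS.1).elim
  exact Set.countable_coe_iff.1 (TopologicalSpace.separableSpace_iff_countable.1 inferInstance)

/-- Extension by zero of a product whose first factor vanishes to second order on the frontier. -/
lemma hasFDerivAt_indicator_comp_mul {Ω : Set E} (hΩ : IsOpen Ω) {w V : E → ℝ}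
    (hw : ContDiff ℝ 1 w) (hV : ContDiff ℝ 1 V) (hw0 : ∀ x ∈ frontier Ω, w x = 0)
    {η η' : ℝ → ℝ} (hη : ∀ s, HasDerivAt η (η' s) s) (hη0 : η 0 = 0) (hη0' : η' 0 = 0) (x : E) :
    HasFDerivAt (Ω.indicator fun y => η (w y) * V y)
      (Ω.indicator (fun y => η (w y) • fderiv ℝ V y + (V y * η' (w y)) • fderiv ℝ w y) x) x := by
  have hmain : HasFDerivAt (fun y => η (w y) * V y)
      (η (w x) • fderiv ℝ V x + (V x * η' (w x)) • fderiv ℝ w x) x := by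
    have h1 := (hη (w x)).comp_hasFDerivAt x ((hw.differentiable one_ne_zero) x).hasFDerivAt
    have h2 := h1.mul ((hV.differentiable one_ne_zero) x).hasFDerivAt
    rw [smul_smul] at h2
    exact h2
  by_cases hx : x ∈ Ω
  · rw [indicator_of_mem hx]
    refine hmain.congr_of_eventuallyEq ?_
    filter_upwards [hΩ.mem_nhds hx] with y hy
    rw [indicator_of_mem hy]
  · rw [indicator_of_notMem hx]
    by_cases hx' : x ∈ frontier Ω
    · have h0 := hw0 x hx'
      rw [h0, hη0, hη0'] at hmain
      simp only [zero_smul, mul_zero, add_zero] at hmain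
      rw [hasFDerivAt_iff_isLittleO] at hmain ⊢
      refine Asymptotics.IsBigO.trans_isLittleO ?_ hmain
      refine Asymptotics.isBigO_of_le _ fun y => ?_
      simp only [zero_apply, sub_zero, indicator_of_notMem hx, h0, hη0, zero_mul]
      exact norm_indicator_le_norm_self _ _
    · have hcl : x ∉ closure Ω := by
        intro hc
        exact hx' (by rw [hΩ.frontier_eq]; exact ⟨hc, hx⟩)
      refine (hasFDerivAt_const (0 : ℝ) x).congr_of_eventuallyEq ?_
      filter_upwards [isClosed_closure.isOpen_compl.mem_nhds hcl] with y hy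
      exact indicator_of_notMem (fun h => hy (subset_closure h)) _

variable [FiniteDimensional ℝ E] [MeasurableSpace E] [BorelSpace E]

/-- The zeros of a `C¹` function at which a directional derivative does not vanish are
negligible. -/
lemma ae_fderiv_eq_zero_of_eq_zero (μ : Measure E) [μ.IsAddHaarMeasure] {f : E → ℝ}
    (hf : ContDiff ℝ 1 f) (v : E) :
    ∀ᵐ x ∂μ, f x = 0 → fderiv ℝ f x v = 0 := by
  have hdf : Continuous fun x => fderiv ℝ f x v :=
    (hf.continuous_fderiv one_ne_zero).clm_apply continuous_const
  have hmeas : MeasurableSet {x | f x = 0 → fderiv ℝ f x v = 0} := by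
    have h1 : MeasurableSet {x | f x = 0} :=
      (isClosed_eq hf.continuous continuous_const).measurableSet
    have h2 : MeasurableSet {x | fderiv ℝ f x v = 0} :=
      (isClosed_eq hdf continuous_const).measurableSet
    exact h1.imp h2
  refine ae_mem_of_ae_add_linearMap_mem (𝕜 := ℝ) (LinearMap.toSpanSingleton ℝ E v) volume μ hmeas ?_
  intro y
  have hg : ∀ s : ℝ, HasDerivAt (fun s : ℝ => f (y + s • v)) (fderiv ℝ f (y + s • v) v) s := by
    intro s
    have h1 : HasDerivAt (fun s : ℝ => y + s • v) v s := by
      simpa using ((hasDerivAt_id s).smul_const v).const_add y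
    exact ((hf.differentiable one_ne_zero) (y + s • v)).hasFDerivAt.comp_hasDerivAt s h1
  have hc := (countable_zero_hasDerivAt_ne hg).ae_notMem volume
  filter_upwards [hc] with s hs h0
  by_contra hne
  exact hs ⟨by simpa using h0, by simpa using hne⟩

/-- Integration by parts on an open set for a function vanishing on the frontier. -/
lemma setIntegral_fderiv_mul_add_eq_zero (μ : Measure E) [μ.IsAddHaarMeasure] {Ω : Set E}
    (hΩ : IsOpen Ω) {w V : E → ℝ}
    (hw : ContDiff ℝ 1 w) (hV : ContDiff ℝ 1 V) (hw0 : ∀ x ∈ frontier Ω, w x = 0)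
    (hsupp : HasCompactSupport w) (v : E) :
    ∫ x in Ω, (fderiv ℝ w x v * V x + w x * fderiv ℝ V x v) ∂μ = 0 := by
  have hwd := hw.continuous_fderiv one_ne_zero
  have hVd := hV.continuous_fderiv one_ne_zero
  have hwv : Continuous fun x => fderiv ℝ w x v := hwd.clm_apply continuous_const
  have hVv : Continuous fun x => fderiv ℝ V x v := hVd.clm_apply continuous_const
  have hwc := hw.continuous
  have hVc := hV.continuous
  have hsuppd : HasCompactSupport fun x => fderiv ℝ w x v := hsupp.fderiv_apply (𝕜 := ℝ) v
  let η : ℕ → ℝ → ℝ := fun n s => s ^ 3 / (s ^ 2 + 1 / ((n : ℝ) + 1))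
  let η' : ℕ → ℝ → ℝ := fun n s =>
    (s ^ 4 + 3 * (1 / ((n : ℝ) + 1)) * s ^ 2) / (s ^ 2 + 1 / ((n : ℝ) + 1)) ^ 2
  have hpos : ∀ (n : ℕ) (s : ℝ), 0 < s ^ 2 + 1 / ((n : ℝ) + 1) := fun n s => by positivity
  have hη : ∀ n s, HasDerivAt (η n) (η' n s) s := by
    intro n s
    have h1 := ((hasDerivAt_id s).pow 3).div (((hasDerivAt_id s).pow 2).add_const
      (1 / ((n : ℝ) + 1))) (hpos n s).ne'
    refine h1.congr_deriv ?_
    simp only [η', Pi.pow_apply, id]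
    congr 1
    push_cast
    ring
  have hηc : ∀ n, Continuous (η n) := fun n =>
    continuous_iff_continuousAt.2 fun s => (hη n s).continuousAt
  have hη'c : ∀ n, Continuous (η' n) := fun n => by
    refine Continuous.div (by fun_prop) (by fun_prop) fun s => pow_ne_zero _ (hpos n s).ne'
  have hη0 : ∀ n, η n 0 = 0 := fun n => by simp [η]
  have hη0' : ∀ n, η' n 0 = 0 := fun n => by simp [η']
  have hηle : ∀ n s, |η n s| ≤ |s| := by
    intro n s
    simp only [η]
    rw [abs_div, abs_of_pos (hpos n s), div_le_iff₀ (hpos n s), abs_pow, pow_succ, sq_abs, mul_comm]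
    have : (0 : ℝ) ≤ 1 / ((n : ℝ) + 1) := by positivity
    gcongr
    linarith
  have hη'le : ∀ n s, |η' n s| ≤ 3 := by
    intro n s
    have h1 : (0 : ℝ) ≤ 1 / ((n : ℝ) + 1) := by positivity
    simp only [η']
    rw [abs_of_nonneg (by positivity), div_le_iff₀ (pow_pos (hpos n s) 2)]
    nlinarith [sq_nonneg s, sq_nonneg (1 / ((n : ℝ) + 1)), mul_nonneg h1 (sq_nonneg s),
      sq_nonneg (s ^ 2)]
  have hlim0 : Tendsto (fun n : ℕ => 1 / ((n : ℝ) + 1)) atTop (𝓝 0) :=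
    tendsto_one_div_add_atTop_nhds_zero_nat
  have hηlim : ∀ s, Tendsto (fun n => η n s) atTop (𝓝 s) := by
    intro s
    by_cases hs : s = 0
    · subst hs; simp [hη0]
    · have : Tendsto (fun n => η n s) atTop (𝓝 (s ^ 3 / (s ^ 2 + 0))) :=
        Tendsto.div tendsto_const_nhds (tendsto_const_nhds.add hlim0) (by simpa using hs)
      convert this using 2
      field_simp
      ring
  have hη'lim : ∀ s, s ≠ 0 → Tendsto (fun n => η' n s) atTop (𝓝 1) := by
    intro s hs
    have : Tendsto (fun n => η' n s) atTop (𝓝 ((s ^ 4 + 3 * 0 * s ^ 2) / (s ^ 2 + 0) ^ 2)) := by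
      refine Tendsto.div ?_ ?_ (by simpa using hs)
      · exact tendsto_const_nhds.add ((tendsto_const_nhds.mul hlim0).mul tendsto_const_nhds)
      · exact (tendsto_const_nhds.add hlim0).pow 2
    convert this using 2
    field_simp
    ring
  have hzero : ∀ n, ∫ x in Ω, (η n (w x) * fderiv ℝ V x v +
      V x * η' n (w x) * fderiv ℝ w x v) ∂μ = 0 := by
    intro n
    have hD := hasFDerivAt_indicator_comp_mul hΩ hw hV hw0 (hη n) (hη0 n) (hη0' n)
    set G := Ω.indicator fun y => η n (w y) * V y with hG
    set D := (Ω.indicator (fun y => η n (w y) • fderiv ℝ V y + (V y * η' n (w y)) • fderiv ℝ w y))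
      with hDdef
    have hDv : ∀ x, D x v = Ω.indicator (fun x => η n (w x) * fderiv ℝ V x v +
      V x * η' n (w x) * fderiv ℝ w x v) x := by
      intro x
      by_cases hx : x ∈ Ω <;> simp [hDdef, hx]
    have hcs : HasCompactSupport fun x => η n (w x) := hsupp.comp_left (hη0 n)
    have hint1 : Integrable (fun y => η n (w y) * V y) μ :=
      Continuous.integrable_of_hasCompactSupport (by fun_prop) (hcs.mul_right)
    have hint2 : Integrable (fun x => η n (w x) * fderiv ℝ V x v +
      V x * η' n (w x) * fderiv ℝ w x v) μ := by
      refine Continuous.integrable_of_hasCompactSupport (by fun_prop) (hcs.mul_right.add ?_)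
      exact hsuppd.mul_left
    have key := integral_bilinear_hasFDerivAt_right_eq_neg_left_of_integrable (μ := μ)
      (f := fun _ => (1 : ℝ)) (f' := fun _ => 0) (g := G) (g' := D) (v := v)
      (B := ContinuousLinearMap.mul ℝ ℝ) (by simp) ?_ ?_ (fun x _ => hasFDerivAt_const _ _)
      (fun x _ => hD x)
    · simp only [ContinuousLinearMap.mul_apply', one_mul, zero_apply, zero_mul,
        integral_zero, neg_zero, hDv] at key
      rwa [integral_indicator hΩ.measurableSet] at key
    · simp only [ContinuousLinearMap.mul_apply', one_mul, hDv]
      exact hint2.indicator hΩ.measurableSet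
    · simp only [ContinuousLinearMap.mul_apply', one_mul]
      exact hint1.indicator hΩ.measurableSet
  have hlim := tendsto_integral_of_dominated_convergence (μ := μ.restrict Ω)
    (F := fun n x => η n (w x) * fderiv ℝ V x v + V x * η' n (w x) * fderiv ℝ w x v)
    (f := fun x => fderiv ℝ w x v * V x + w x * fderiv ℝ V x v)
    (fun x => |w x * fderiv ℝ V x v| + |V x * 3 * fderiv ℝ w x v|) ?_ ?_ ?_ ?_
  · simp only [hzero] at hlim
    exact tendsto_nhds_unique hlim tendsto_const_nhds
  · intro n
    exact Continuous.aestronglyMeasurable (by fun_prop)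
  · refine Integrable.restrict (Continuous.integrable_of_hasCompactSupport (by fun_prop) ?_)
    refine HasCompactSupport.add ?_ ?_
    · exact (hsupp.mul_right).comp_left (g := fun s : ℝ => |s|) abs_zero
    · exact (hsuppd.mul_left).comp_left (g := fun s : ℝ => |s|) abs_zero
  · intro n
    refine Eventually.of_forall fun x => ?_
    refine (norm_add_le _ _).trans (add_le_add ?_ ?_)
    · simp only [norm_eq_abs, abs_mul]
      exact mul_le_mul_of_nonneg_right (hηle n _) (abs_nonneg _)
    · simp only [norm_eq_abs, abs_mul]
      exact mul_le_mul_of_nonneg_right (mul_le_mul_of_nonneg_left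
        ((hη'le n _).trans (le_abs_self _)) (abs_nonneg _)) (abs_nonneg _)
  · filter_upwards [ae_restrict_of_ae (ae_fderiv_eq_zero_of_eq_zero μ hw v)] with x hx
    by_cases h0 : w x = 0
    · simp [h0, hη0, hη0', hx h0]
    · have := ((hηlim (w x)).mul_const (fderiv ℝ V x v)).add
        (((hη'lim (w x) h0).const_mul (V x)).mul_const (fderiv ℝ w x v))
      convert this using 2
      ring

end Divergence

section JointDerivatives

variable {N : ℕ}

/-- The derivative of `W` in the fixed direction `v`. -/
noncomputable def dirDeriv {G : Type*} [NormedAddCommGroup G] [NormedSpace ℝ G] (v : G)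
    (W : G → ℝ) : G → ℝ :=
  fun p => fderiv ℝ W p v

/-- The time derivative of a function on space-time. -/
noncomputable abbrev timeDeriv (W : EuclideanSpace ℝ (Fin N) × ℝ → ℝ) :
    EuclideanSpace ℝ (Fin N) × ℝ → ℝ :=
  dirDeriv ((0 : EuclideanSpace ℝ (Fin N)), (1 : ℝ)) W

/-- The `i`-th spatial derivative of a function on space-time. -/
noncomputable abbrev spaceDeriv (i : Fin N) (W : EuclideanSpace ℝ (Fin N) × ℝ → ℝ) :
    EuclideanSpace ℝ (Fin N) × ℝ → ℝ :=
  dirDeriv (EuclideanSpace.single i (1 : ℝ), (0 : ℝ)) W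

section

variable {G : Type*} [NormedAddCommGroup G] [NormedSpace ℝ G]

lemma ContDiff.dirDeriv {W : G → ℝ} (hW : ContDiff ℝ (⊤ : ℕ∞) W) (v : G) :
    ContDiff ℝ (⊤ : ℕ∞) (dirDeriv v W) :=
  (hW.fderiv_right (m := ((⊤ : ℕ∞) : WithTop ℕ∞)) (by simp)).clm_apply contDiff_const

lemma dirDeriv_comm {W : G → ℝ} (hW : ContDiff ℝ (⊤ : ℕ∞) W) (v v' : G) :
    dirDeriv v (dirDeriv v' W) = dirDeriv v' (dirDeriv v W) := by
  have h1 : ∀ p, DifferentiableAt ℝ (fderiv ℝ W) p := fun p =>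
    ((hW.fderiv_right (m := 1)
      (WithTop.coe_le_coe.2 (le_top (a := ((1 + 1 : ℕ∞)))))).differentiable one_ne_zero) p
  have h2 : ∀ (v v' p : G), dirDeriv v (dirDeriv v' W) p = fderiv ℝ (fderiv ℝ W) p v v' := by
    intro v v' p
    change fderiv ℝ (fun q => fderiv ℝ W q v') p v = _
    rw [fderiv_clm_apply (h1 p) (differentiableAt_const _)]
    simp
  funext p
  rw [h2, h2]
  have hs : IsSymmSndFDerivAt ℝ W p := by
    refine hW.contDiffAt.isSymmSndFDerivAt ?_
    simp only [minSmoothness_of_isRCLikeNormedField]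
    exact WithTop.coe_le_coe.2 (le_top (a := (2 : ℕ∞)))
  exact hs.eq v v'

end

lemma hasDerivAt_time {W : EuclideanSpace ℝ (Fin N) × ℝ → ℝ} {x : EuclideanSpace ℝ (Fin N)}
    {s : ℝ} (hW : DifferentiableAt ℝ W (x, s)) :
    HasDerivAt (fun s => W (x, s)) (timeDeriv W (x, s)) s :=
  hW.hasFDerivAt.comp_hasDerivAt s ((hasDerivAt_const s x).prodMk (hasDerivAt_id s))

lemma hasFDerivAt_space {W : EuclideanSpace ℝ (Fin N) × ℝ → ℝ} {x : EuclideanSpace ℝ (Fin N)}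
    {s : ℝ} (hW : DifferentiableAt ℝ W (x, s)) :
    HasFDerivAt (fun y => W (y, s))
      ((fderiv ℝ W (x, s)).comp (ContinuousLinearMap.inl ℝ _ ℝ)) x :=
  hW.hasFDerivAt.comp x ((hasFDerivAt_id x).prodMk (hasFDerivAt_const s x))

lemma fderiv_space {W : EuclideanSpace ℝ (Fin N) × ℝ → ℝ} {x : EuclideanSpace ℝ (Fin N)}
    {s : ℝ} (hW : DifferentiableAt ℝ W (x, s)) (i : Fin N) :
    fderiv ℝ (fun y => W (y, s)) x (EuclideanSpace.single i 1) = spaceDeriv i W (x, s) := by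
  rw [(hasFDerivAt_space hW).fderiv]
  simp [dirDeriv]

lemma timeDeriv_spaceDeriv {W : EuclideanSpace ℝ (Fin N) × ℝ → ℝ}
    (hW : ContDiff ℝ (⊤ : ℕ∞) W) (i : Fin N) :
    timeDeriv (spaceDeriv i W) = spaceDeriv i (timeDeriv W) :=
  dirDeriv_comm hW _ _

lemma deriv_iterate_time {W : EuclideanSpace ℝ (Fin N) × ℝ → ℝ}
    (hW : ContDiff ℝ (⊤ : ℕ∞) W) (x : EuclideanSpace ℝ (Fin N)) (k : ℕ) :
    ContDiff ℝ (⊤ : ℕ∞) (timeDeriv^[k] W) ∧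
      deriv^[k] (fun s => W (x, s)) = fun s => timeDeriv^[k] W (x, s) := by
  induction k with
  | zero => exact ⟨hW, rfl⟩
  | succ k ih =>
    rw [Function.iterate_succ_apply', Function.iterate_succ_apply', ih.2]
    refine ⟨ih.1.dirDeriv _, funext fun s => ?_⟩
    exact (hasDerivAt_time ((ih.1.differentiable (by simp)) _)).deriv

lemma lap_space {W : EuclideanSpace ℝ (Fin N) × ℝ → ℝ}
    (hW : ContDiff ℝ (⊤ : ℕ∞) W) (x : EuclideanSpace ℝ (Fin N)) (s : ℝ) :
    lap (fun y => W (y, s)) x = ∑ i, spaceDeriv i (spaceDeriv i W) (x, s) := by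
  refine Finset.sum_congr rfl fun i _ => ?_
  have : (fun y => fderiv ℝ (fun y => W (y, s)) y (EuclideanSpace.single i 1)) =
      fun y => spaceDeriv i W (y, s) :=
    funext fun y => fderiv_space ((hW.differentiable (by simp)) _) i
  rw [this]
  exact fderiv_space (((hW.dirDeriv _).differentiable (by simp)) _) i

lemma sum_sq_eq_norm_gradient_sq (f : EuclideanSpace ℝ (Fin N) → ℝ)
    (x : EuclideanSpace ℝ (Fin N)) :
    ‖gradient f x‖ ^ 2 = ∑ i, (fderiv ℝ f x (EuclideanSpace.single i 1)) ^ 2 := by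
  rw [EuclideanSpace.norm_sq_eq]
  refine Finset.sum_congr rfl fun i _ => ?_
  rw [← inner_gradient_left (𝕜 := ℝ), EuclideanSpace.inner_single_right]
  simp

/-- Smooth solutions of the damped wave equation `w_tt - Δw + a w_t = 0` on `Ω`, vanishing on the
boundary and outside of the ball of radius `R + t`. -/
structure IsDampedWave (Ω : Set (EuclideanSpace ℝ (Fin N))) (a : EuclideanSpace ℝ (Fin N) → ℝ)
    (R : ℝ) (W : EuclideanSpace ℝ (Fin N) × ℝ → ℝ) : Prop where
  smooth : ContDiff ℝ (⊤ : ℕ∞) W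
  eqn : ∀ x ∈ Ω, ∀ s > (0 : ℝ), timeDeriv (timeDeriv W) (x, s) =
    (∑ i, spaceDeriv i (spaceDeriv i W) (x, s)) - a x * timeDeriv W (x, s)
  bdry : ∀ x ∈ frontier Ω, ∀ s > (0 : ℝ), W (x, s) = 0
  supp : ∀ s > (0 : ℝ), ∀ x, R + s < ‖x‖ → W (x, s) = 0

namespace IsDampedWave

variable {Ω : Set (EuclideanSpace ℝ (Fin N))} {a : EuclideanSpace ℝ (Fin N) → ℝ} {R : ℝ}
  {W : EuclideanSpace ℝ (Fin N) × ℝ → ℝ}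

lemma timeDeriv (h : IsDampedWave Ω a R W) :
    IsDampedWave Ω a R (timeDeriv W) := by
  refine ⟨h.smooth.dirDeriv _, fun x hx s hs => ?_, fun x hx s hs => ?_, fun s hs x hx => ?_⟩
  · have hd1 := hasDerivAt_time
      ((((h.smooth.dirDeriv (0, 1)).dirDeriv (0, 1)).differentiable (by simp)) (x, s))
    have hd2 : HasDerivAt (fun s => (∑ i, spaceDeriv i (spaceDeriv i W) (x, s)) -
        a x * _root_.timeDeriv W (x, s))
        ((∑ i, _root_.timeDeriv (spaceDeriv i (spaceDeriv i W)) (x, s)) -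
        a x * _root_.timeDeriv (_root_.timeDeriv W) (x, s)) s := by
      refine HasDerivAt.sub (HasDerivAt.fun_sum fun i _ => ?_) (HasDerivAt.const_mul _ ?_)
      · exact hasDerivAt_time
          ((((h.smooth.dirDeriv _).dirDeriv _).differentiable (by simp)) (x, s))
      · exact hasDerivAt_time ((((h.smooth.dirDeriv _)).differentiable (by simp)) (x, s))
    have heq : (fun s => _root_.timeDeriv (_root_.timeDeriv W) (x, s)) =ᶠ[𝓝 s]
        (fun s => (∑ i, spaceDeriv i (spaceDeriv i W) (x, s)) -
        a x * _root_.timeDeriv W (x, s)) := by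
      filter_upwards [isOpen_Ioi.mem_nhds hs] with r hr using h.eqn x hx r hr
    rw [hd1.unique (hd2.congr_of_eventuallyEq heq)]
    congr 1
    refine Finset.sum_congr rfl fun i _ => ?_
    rw [timeDeriv_spaceDeriv (h.smooth.dirDeriv _), timeDeriv_spaceDeriv h.smooth]
  · have hd := hasDerivAt_time ((h.smooth.differentiable (by simp)) (x, s))
    refine hd.unique ((hasDerivAt_const s (0 : ℝ)).congr_of_eventuallyEq ?_)
    filter_upwards [isOpen_Ioi.mem_nhds hs] with r hr using h.bdry x hx r hr
  · have hd := hasDerivAt_time ((h.smooth.differentiable (by simp)) (x, s))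
    refine hd.unique ((hasDerivAt_const s (0 : ℝ)).congr_of_eventuallyEq ?_)
    have h1 : ∀ᶠ r in 𝓝 s, R + r < ‖x‖ :=
      (continuous_const.add continuous_id).continuousAt.eventually_lt continuousAt_const hx
    filter_upwards [isOpen_Ioi.mem_nhds hs, h1] with r hr hr' using h.supp r hr x hr'

lemma iterate_timeDeriv (h : IsDampedWave Ω a R W) (k : ℕ) :
    IsDampedWave Ω a R (_root_.timeDeriv^[k] W) := by
  induction k with
  | zero => exact h
  | succ k ih => rw [Function.iterate_succ_apply']; exact ih.timeDeriv

lemma eqn_zero (h : IsDampedWave Ω a R W) {x : EuclideanSpace ℝ (Fin N)} (hx : x ∈ Ω) :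
    _root_.timeDeriv (_root_.timeDeriv W) (x, 0) =
    (∑ i, spaceDeriv i (spaceDeriv i W) (x, 0)) - a x * _root_.timeDeriv W (x, 0) := by
  have hc1 : Continuous fun s : ℝ => _root_.timeDeriv (_root_.timeDeriv W) (x, s) :=
    ((h.smooth.dirDeriv _).dirDeriv _).continuous.comp (by fun_prop)
  have hc2 : Continuous fun s : ℝ => (∑ i, spaceDeriv i (spaceDeriv i W) (x, s)) -
      a x * _root_.timeDeriv W (x, s) := by
    refine (continuous_finsetSum _ fun i _ => ?_).sub (continuous_const.mul ?_)
    · exact ((h.smooth.dirDeriv _).dirDeriv _).continuous.comp (by fun_prop)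
    · exact (h.smooth.dirDeriv _).continuous.comp (by fun_prop)
  have heq : EqOn (fun s : ℝ => _root_.timeDeriv (_root_.timeDeriv W) (x, s))
      (fun s : ℝ => (∑ i, spaceDeriv i (spaceDeriv i W) (x, s)) -
      a x * _root_.timeDeriv W (x, s)) (Ioi 0) := fun s hs => h.eqn x hx s hs
  exact heq.closure hc1 hc2 (by simp)

lemma supp_zero (h : IsDampedWave Ω a R W) {s : ℝ} (hs : 0 ≤ s) {x : EuclideanSpace ℝ (Fin N)}
    (hx : R + s < ‖x‖) : W (x, s) = 0 := by
  have hc1 : Continuous fun s : ℝ => W (x, s) := h.smooth.continuous.comp (by fun_prop)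
  rcases hs.eq_or_lt with rfl | hs
  · have heq : EqOn (fun s : ℝ => W (x, s)) (fun _ => 0) (Ioo 0 (‖x‖ - R)) :=
      fun s hs => h.supp s hs.1 x (by linarith [hs.2])
    refine heq.closure hc1 continuous_const ?_
    rw [closure_Ioo (by linarith)]
    exact ⟨le_rfl, by linarith⟩
  · exact h.supp s hs x hx

lemma spaceDeriv_supp (h : IsDampedWave Ω a R W) {s : ℝ} (hs : 0 ≤ s)
    {x : EuclideanSpace ℝ (Fin N)} (hx : R + s < ‖x‖) (i : Fin N) :
    spaceDeriv i W (x, s) = 0 := by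
  rw [← fderiv_space ((h.smooth.differentiable (by simp)) _)]
  have : (fun y => W (y, s)) =ᶠ[𝓝 x] fun _ => 0 := by
    have h1 : ∀ᶠ y in 𝓝 x, R + s < ‖y‖ :=
      continuousAt_const.eventually_lt continuous_norm.continuousAt hx
    filter_upwards [h1] with y hy using h.supp_zero hs hy
  rw [this.fderiv_eq]
  simp

end IsDampedWave

end JointDerivatives

section ParametricIntegral

variable {E : Type*} [NormedAddCommGroup E] [NormedSpace ℝ E] [FiniteDimensional ℝ E]
  [MeasurableSpace E] [BorelSpace E]

lemma Continuous.integrableOn_of_subset_closedBall {μ : Measure E} [IsLocallyFiniteMeasure μ]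
    {f : E → ℝ} (hf : Continuous f) {S : Set E} {r : ℝ} (hS : S ⊆ Metric.closedBall 0 r) :
    IntegrableOn f S μ :=
  (hf.continuousOn.integrableOn_compact (isCompact_closedBall 0 r)).mono_set hS

/-- Differentiation under the integral sign over a bounded set. -/
lemma hasDerivAt_setIntegral_of_continuousOn {μ : Measure E} [IsLocallyFiniteMeasure μ]
    {f f' : E → ℝ → ℝ} {S : Set E} {r : ℝ} (hSm : MeasurableSet S)
    (hS : S ⊆ Metric.closedBall 0 r)
    (hf : ContinuousOn (fun q : E × ℝ => f q.1 q.2) (univ ×ˢ Ioi (-1)))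
    (hf' : ContinuousOn (fun q : E × ℝ => f' q.1 q.2) (univ ×ˢ Ioi (-1)))
    (hd : ∀ x, ∀ t > (-1 : ℝ), HasDerivAt (f x) (f' x t) t) {t : ℝ} (ht : -1 < t) :
    HasDerivAt (fun t => ∫ x in S, f x t ∂μ) (∫ x in S, f' x t ∂μ) t := by
  have slice : ∀ {g : E → ℝ → ℝ}, ContinuousOn (fun q : E × ℝ => g q.1 q.2) (univ ×ˢ Ioi (-1)) →
      ∀ s > (-1 : ℝ), Continuous fun x => g x s := by
    intro g hg s hs
    have h1 : Continuous fun x : E => (x, s) := by fun_prop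
    exact hg.comp_continuous h1 fun x => ⟨mem_univ _, hs⟩
  have hnhds : Ioo ((t - 1) / 2) (t + 1) ∈ 𝓝 t := Ioo_mem_nhds (by linarith) (by linarith)
  obtain ⟨C, hC⟩ := ((isCompact_closedBall (0 : E) r).prod
    (isCompact_Icc (a := (t - 1) / 2) (b := t + 1))).exists_bound_of_continuousOn
    (hf'.mono fun q hq => ⟨mem_univ _, by
      have := hq.2.1
      simp only [mem_Ioi]; linarith⟩)
  have hfin : μ S < ⊤ := (measure_mono hS).trans_lt (isCompact_closedBall 0 r).measure_lt_top
  refine (hasDerivAt_integral_of_dominated_loc_of_deriv_le (μ := μ.restrict S)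
    (F := fun t x => f x t) (F' := fun t x => f' x t) (bound := fun _ => C)
    hnhds ?_ ?_ ?_ ?_ ?_ ?_).2
  · filter_upwards [isOpen_Ioi.mem_nhds (show t ∈ Ioi (-1 : ℝ) from ht)] with s hs
    exact (slice hf s hs).aestronglyMeasurable
  · exact (slice hf t ht).integrableOn_of_subset_closedBall hS
  · exact (slice hf' t ht).aestronglyMeasurable
  · refine (ae_restrict_iff' hSm).2 (Eventually.of_forall fun x hx s hs => ?_)
    exact hC (x, s) ⟨hS hx, hs.1.le, hs.2.le⟩
  · exact integrableOn_const (hs := hfin.ne)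
  · exact Eventually.of_forall fun x s hs => hd x s (by have := hs.1; linarith)

end ParametricIntegral

/-- The pointwise inequality behind the weighted energy estimate. -/
lemma energy_integrand_le {P s q L r D W Z a lam T σ η ν κ K β p m M : ℝ}
    (ha : 0 < a) (hT : 0 < T) (hlam : 0 ≤ lam) (hP : 0 ≤ P) (hs : s ^ 2 ≤ P * q)
    (hW : 0 ≤ P + 2 * W * s + W ^ 2 * q) (hq : q ≤ (1 - ν) * a * lam) (hK : lam ≤ K * a)
    (hD : β * a / T ≤ D) (hη : 0 < η) (hη' : 2 * η ≤ 1) (hν : 0 < ν) (hκ : 0 < κ) (hσ : 0 < σ)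
    (hsplit : (1 - 2 * η) * β = m + κ) (hsig : σ * (1 + M) ≤ 2 * η)
    (hbig : K / ν + 2 + σ * (1 + M) + M ^ 2 / κ ≤ σ / 2 * (T * a)) (hone : 1 ≤ T * a)
    (hp : 0 ≤ p) (hpM : p ≤ M) :
    -lam * (2 * W * Z + a * W ^ 2 + σ * T * (P + Z ^ 2)) + 2 * Z ^ 2 + 2 * W * (L - a * Z)
      + 2 * a * W * Z + σ * (P + Z ^ 2) + σ * T * (2 * r + 2 * Z * (L - a * Z))
      - (2 * P + 2 * (1 - 2 * η) * W * s + 2 * W * s + (1 - 2 * η) * W ^ 2 * q + 2 * W * L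
        + (1 - 2 * η) * W ^ 2 * D + 2 * σ * T * r + 2 * σ * T * Z * (s + L))
      + p / T * (2 * W * Z + a * W ^ 2 + σ * T * (P + Z ^ 2))
    ≤ (p - m) / T * (a * W ^ 2) - σ / 2 * T * (a * Z ^ 2) := by
  have h1 : -(2 * lam * W * Z) ≤ ν * lam * a * W ^ 2 + K / ν * Z ^ 2 := by
    have e1 : 0 ≤ lam * (ν * a * W + Z) ^ 2 / (ν * a) := by positivity
    have e2 : lam * (ν * a * W + Z) ^ 2 / (ν * a)
        = ν * lam * a * W ^ 2 + 2 * lam * W * Z + lam / (ν * a) * Z ^ 2 := by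
      field_simp
      ring
    have e3 : lam / (ν * a) ≤ K / ν := by
      rw [div_le_div_iff₀ (by positivity) hν]
      linarith [mul_le_mul_of_nonneg_right hK hν.le]
    have e4 := mul_le_mul_of_nonneg_right e3 (sq_nonneg Z)
    linarith
  have h2 : W ^ 2 * q ≤ (1 - ν) * a * lam * W ^ 2 := by
    linarith [mul_le_mul_of_nonneg_left hq (sq_nonneg W)]
  have h3 : 0 ≤ σ * T * (a * Z ^ 2 + 2 * Z * s + lam * P) := by
    have e0 : P * q ≤ P * ((1 - ν) * a * lam) := mul_le_mul_of_nonneg_left hq hP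
    have e1 : 0 ≤ ν * (P * (a * lam)) := by positivity
    have e2 : 0 ≤ a * (a * Z ^ 2 + 2 * Z * s + lam * P) := by
      linarith [sq_nonneg (a * Z + s)]
    have e3 : 0 ≤ a * Z ^ 2 + 2 * Z * s + lam * P := nonneg_of_mul_nonneg_right e2 ha
    positivity
  have h4 : (m + κ) * a / T * W ^ 2 ≤ (1 - 2 * η) * W ^ 2 * D := by
    have e1 : 0 ≤ (1 - 2 * η) * W ^ 2 := mul_nonneg (by linarith) (sq_nonneg W)
    have e2 := mul_le_mul_of_nonneg_left hD e1
    have e3 : (m + κ) * a / T * W ^ 2 = (1 - 2 * η) * W ^ 2 * (β * a / T) := by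
      rw [← hsplit]; ring
    linarith
  have h5 : p / T * (2 * W * Z) ≤ κ * a / T * W ^ 2 + M ^ 2 / κ * Z ^ 2 := by
    have e1 : 0 ≤ (κ * a * W - p * Z) ^ 2 / (κ * a * T) := by positivity
    have e2 : (κ * a * W - p * Z) ^ 2 / (κ * a * T)
        = κ * a / T * W ^ 2 - p / T * (2 * W * Z) + p ^ 2 / (κ * (T * a)) * Z ^ 2 := by
      field_simp
      ring
    have e3 : p ^ 2 / (κ * (T * a)) ≤ M ^ 2 / κ := by
      have : p ^ 2 ≤ M ^ 2 := by gcongr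
      gcongr
      exact le_mul_of_one_le_right hκ.le hone
    have e4 := mul_le_mul_of_nonneg_right e3 (sq_nonneg Z)
    linarith
  have hpσ : σ * p ≤ σ * M := mul_le_mul_of_nonneg_left hpM hσ.le
  have h6 : (σ + p * σ - 2 * η) * P ≤ 0 :=
    mul_nonpos_of_nonpos_of_nonneg (by linarith) hP
  have h7 : (K / ν + 2 + σ + p * σ + M ^ 2 / κ) * Z ^ 2 ≤ σ / 2 * (T * a) * Z ^ 2 :=
    mul_le_mul_of_nonneg_right (by linarith) (sq_nonneg Z)
  have h8 : 0 ≤ lam * (σ * T * Z ^ 2) := by positivity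
  have h9 : 0 ≤ (1 - η) * (P + 2 * W * s + W ^ 2 * q) := mul_nonneg (by linarith) hW
  have e1 : p / T * (2 * W * Z + a * W ^ 2 + σ * T * (P + Z ^ 2))
      = p / T * (2 * W * Z) + p * a / T * W ^ 2 + p * σ * (P + Z ^ 2) := by
    field_simp
  have e2 : (p - m) / T * (a * W ^ 2) = p * a / T * W ^ 2 - m * a / T * W ^ 2 := by ring
  have e3 : (m + κ) * a / T * W ^ 2 = m * a / T * W ^ 2 + κ * a / T * W ^ 2 := by ring
  rw [e1, e2]
  rw [e3] at h4
  linear_combination h1 + h2 + h3 + h4 + h5 + h6 + h7 + h8 + 2 * h9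

section Energy

variable {N : ℕ}

/-- The exponential weight `exp (β (A + c) / (1 + t))`. -/
noncomputable def expWeight (A : EuclideanSpace ℝ (Fin N) → ℝ) (β c : ℝ)
    (x : EuclideanSpace ℝ (Fin N)) (t : ℝ) : ℝ :=
  exp (β * (A x + c) / (1 + t))

/-- The energy density `Φ (2 w w_t + a w² + σ (t₀ + t) (|∇w|² + w_t²))`. -/
noncomputable def energyDensity (a A : EuclideanSpace ℝ (Fin N) → ℝ) (β c t₀ σ : ℝ)
    (W : EuclideanSpace ℝ (Fin N) × ℝ → ℝ) (x : EuclideanSpace ℝ (Fin N)) (t : ℝ) : ℝ :=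
  expWeight A β c x t * (2 * W (x, t) * timeDeriv W (x, t) + a x * W (x, t) ^ 2
    + σ * (t₀ + t) * ((∑ i, spaceDeriv i W (x, t) ^ 2) + timeDeriv W (x, t) ^ 2))

/-- The time derivative of `energyDensity`. -/
noncomputable def energyDensityDeriv (a A : EuclideanSpace ℝ (Fin N) → ℝ) (β c t₀ σ : ℝ)
    (W : EuclideanSpace ℝ (Fin N) × ℝ → ℝ) (x : EuclideanSpace ℝ (Fin N)) (t : ℝ) : ℝ :=
  expWeight A β c x t *
    (-(β * (A x + c) / (1 + t) ^ 2) * (2 * W (x, t) * timeDeriv W (x, t) + a x * W (x, t) ^ 2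
      + σ * (t₀ + t) * ((∑ i, spaceDeriv i W (x, t) ^ 2) + timeDeriv W (x, t) ^ 2))
    + 2 * timeDeriv W (x, t) ^ 2 + 2 * W (x, t) * timeDeriv (timeDeriv W) (x, t)
    + 2 * a x * W (x, t) * timeDeriv W (x, t)
    + σ * ((∑ i, spaceDeriv i W (x, t) ^ 2) + timeDeriv W (x, t) ^ 2)
    + σ * (t₀ + t) * (2 * (∑ i, spaceDeriv i W (x, t) * spaceDeriv i (timeDeriv W) (x, t))
      + 2 * timeDeriv W (x, t) * timeDeriv (timeDeriv W) (x, t)))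

variable {a A : EuclideanSpace ℝ (Fin N) → ℝ} {β c t₀ σ : ℝ}
  {W : EuclideanSpace ℝ (Fin N) × ℝ → ℝ}

lemma expWeight_pos (x : EuclideanSpace ℝ (Fin N)) (t : ℝ) : 0 < expWeight A β c x t :=
  exp_pos _

lemma continuousOn_expWeight (hA : Continuous A) :
    ContinuousOn (fun q : EuclideanSpace ℝ (Fin N) × ℝ => expWeight A β c q.1 q.2)
      (univ ×ˢ Ioi (-1)) := by
  refine continuous_exp.comp_continuousOn (ContinuousOn.div (by fun_prop) (by fun_prop) ?_)
  intro q hq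
  have : -1 < q.2 := hq.2
  linarith

lemma hasDerivAt_expWeight (x : EuclideanSpace ℝ (Fin N)) {t : ℝ} (ht : -1 < t) :
    HasDerivAt (expWeight A β c x)
      (expWeight A β c x t * (-(β * (A x + c) / (1 + t) ^ 2))) t := by
  have h1 : HasDerivAt (fun t : ℝ => 1 + t) 1 t := (hasDerivAt_id t).const_add 1
  have h2 := ((hasDerivAt_const t (β * (A x + c))).div h1 (by linarith)).exp
  refine h2.congr_deriv ?_
  simp [expWeight, neg_div]

lemma hasDerivAt_energyDensity (hW : ContDiff ℝ (⊤ : ℕ∞) W) (x : EuclideanSpace ℝ (Fin N))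
    {t : ℝ} (ht : -1 < t) :
    HasDerivAt (energyDensity a A β c t₀ σ W x) (energyDensityDeriv a A β c t₀ σ W x t) t := by
  have hd : ∀ {U : EuclideanSpace ℝ (Fin N) × ℝ → ℝ}, ContDiff ℝ (⊤ : ℕ∞) U →
      HasDerivAt (fun s => U (x, s)) (timeDeriv U (x, t)) t := fun hU =>
    hasDerivAt_time ((hU.differentiable (by simp)) _)
  have hZ := hd (hW.dirDeriv (0, 1))
  have hY : HasDerivAt (fun s => ∑ i, spaceDeriv i W (x, s) ^ 2)
      (∑ i, 2 * (spaceDeriv i W (x, t) * spaceDeriv i (timeDeriv W) (x, t))) t := by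
    refine HasDerivAt.fun_sum fun i _ => ?_
    have := (hd (hW.dirDeriv (EuclideanSpace.single i (1 : ℝ), (0 : ℝ)))).fun_pow 2
    refine this.congr_deriv ?_
    rw [timeDeriv_spaceDeriv hW]
    push_cast
    ring
  have h1 := (((hd hW).const_mul 2).mul hZ).add (((hd hW).fun_pow 2).const_mul (a x))
  have h2 : HasDerivAt (fun s : ℝ => σ * (t₀ + s)) σ t := by
    simpa using ((hasDerivAt_id t).const_add t₀).const_mul σ
  have h3 := h1.add (h2.mul (hY.add (hZ.fun_pow 2)))
  have h4 := (hasDerivAt_expWeight (A := A) (β := β) (c := c) x ht).mul h3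
  refine h4.congr_deriv ?_
  simp only [energyDensityDeriv, ← Finset.mul_sum, Pi.add_apply, Pi.mul_apply]
  push_cast
  ring

lemma continuousOn_energyDensity (ha : Continuous a) (hA : Continuous A)
    (hW : ContDiff ℝ (⊤ : ℕ∞) W) :
    ContinuousOn (fun q : EuclideanSpace ℝ (Fin N) × ℝ => energyDensity a A β c t₀ σ W q.1 q.2)
      (univ ×ˢ Ioi (-1)) := by
  have h1 : Continuous W := hW.continuous
  have h2 : Continuous (timeDeriv W) := (hW.dirDeriv _).continuous
  have h3 : ∀ i, Continuous (spaceDeriv i W) := fun i => (hW.dirDeriv _).continuous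
  refine (continuousOn_expWeight hA).mul (Continuous.continuousOn ?_)
  fun_prop

lemma continuousOn_energyDensityDeriv (ha : Continuous a) (hA : Continuous A)
    (hW : ContDiff ℝ (⊤ : ℕ∞) W) :
    ContinuousOn
      (fun q : EuclideanSpace ℝ (Fin N) × ℝ => energyDensityDeriv a A β c t₀ σ W q.1 q.2)
      (univ ×ˢ Ioi (-1)) := by
  have h1 : Continuous W := hW.continuous
  have h2 : Continuous (timeDeriv W) := (hW.dirDeriv _).continuous
  have h3 : ∀ i, Continuous (spaceDeriv i W) := fun i => (hW.dirDeriv _).continuous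
  have h4 : Continuous (timeDeriv (timeDeriv W)) := ((hW.dirDeriv _).dirDeriv _).continuous
  have h5 : ∀ i, Continuous (spaceDeriv i (timeDeriv W)) :=
    fun i => ((hW.dirDeriv _).dirDeriv _).continuous
  have h6 : ContinuousOn (fun q : EuclideanSpace ℝ (Fin N) × ℝ =>
      β * (A q.1 + c) / (1 + q.2) ^ 2) (univ ×ˢ Ioi (-1)) := by
    refine ContinuousOn.div (by fun_prop) (by fun_prop) ?_
    intro q hq
    have : -1 < q.2 := hq.2
    exact pow_ne_zero _ (by linarith)
  refine (continuousOn_expWeight hA).mul ?_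
  fun_prop

lemma fderiv_expWeight_mul (hA : ContDiff ℝ 2 A) {f : EuclideanSpace ℝ (Fin N) → ℝ} {t : ℝ}
    {x v : EuclideanSpace ℝ (Fin N)} (hf : DifferentiableAt ℝ f x) :
    fderiv ℝ (fun y => expWeight A β c y t * f y) x v =
      expWeight A β c x t * (β * fderiv ℝ A x v / (1 + t) * f x + fderiv ℝ f x v) := by
  have hAx := ((hA.differentiable two_ne_zero) x).hasFDerivAt
  have h1 : HasFDerivAt (fun y => β * (A y + c) / (1 + t)) ((β / (1 + t)) • fderiv ℝ A x) x := by
    have := (hAx.add_const c).const_mul (β / (1 + t))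
    refine this.congr_of_eventuallyEq (Eventually.of_forall fun y => ?_)
    change β * (A y + c) / (1 + t) = β / (1 + t) * (A y + c)
    ring
  have h2 := h1.exp.mul hf.hasFDerivAt
  have h3 : fderiv ℝ (fun y => expWeight A β c y t * f y) x = _ := h2.fderiv
  rw [h3]
  simp only [expWeight, add_apply, smul_apply, smul_eq_mul]
  ring

lemma contDiff_expWeight (hA : ContDiff ℝ 2 A) (t : ℝ) :
    ContDiff ℝ 1 fun y => expWeight A β c y t := by
  have := hA.of_le one_le_two
  unfold expWeight
  fun_prop

end Energy

section Flux

variable {N : ℕ}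

/-- The divergence of a vector field which factors through a function vanishing on the frontier
and outside a ball integrates to zero. -/
lemma setIntegral_div_eq_zero {Ω : Set (EuclideanSpace ℝ (Fin N))} (hΩ : IsOpen Ω)
    {U : EuclideanSpace ℝ (Fin N) → ℝ} {V : Fin N → EuclideanSpace ℝ (Fin N) → ℝ}
    (hU : ContDiff ℝ 1 U) (hV : ∀ i, ContDiff ℝ 1 (V i)) (hU0 : ∀ x ∈ frontier Ω, U x = 0)
    {ρ r : ℝ} (hρ : ρ ≤ r) (hsupp : ∀ x, ρ < ‖x‖ → U x = 0) :
    ∫ x in Ω ∩ Metric.closedBall 0 r, ∑ i, (fderiv ℝ U x (EuclideanSpace.single i 1) * V i x +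
      U x * fderiv ℝ (V i) x (EuclideanSpace.single i 1)) = 0 := by
  have hcs : HasCompactSupport U := by
    refine HasCompactSupport.of_support_subset_isCompact (isCompact_closedBall 0 ρ) fun x hx => ?_
    by_contra hx'
    exact hx (hsupp x (by simpa using hx'))
  have hUd := hU.continuous_fderiv one_ne_zero
  have hVd := fun i => (hV i).continuous_fderiv one_ne_zero
  have hUc := hU.continuous
  have hVc := fun i => (hV i).continuous
  have hterm : ∀ i, Continuous fun x => fderiv ℝ U x (EuclideanSpace.single i 1) * V i x +
      U x * fderiv ℝ (V i) x (EuclideanSpace.single i 1) := by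
    intro i
    have h1 : Continuous fun x => fderiv ℝ U x (EuclideanSpace.single i 1) :=
      hUd.clm_apply continuous_const
    have h2 : Continuous fun x => fderiv ℝ (V i) x (EuclideanSpace.single i 1) :=
      (hVd i).clm_apply continuous_const
    fun_prop
  rw [integral_finsetSum _ fun i _ =>
    (hterm i).integrableOn_of_subset_closedBall Set.inter_subset_right]
  refine Finset.sum_eq_zero fun i _ => ?_
  rw [← setIntegral_eq_of_subset_of_forall_sdiff_eq_zero hΩ.measurableSet Set.inter_subset_left]
  · exact setIntegral_fderiv_mul_add_eq_zero volume hΩ hU (hV i) hU0 hcs _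
  · rintro x ⟨hx, hx'⟩
    have hxr : ρ < ‖x‖ := by
      by_contra hle
      exact hx' ⟨hx, by simpa using (not_lt.1 hle).trans hρ⟩
    have : U =ᶠ[𝓝 x] fun _ => 0 := by
      filter_upwards [continuousAt_const.eventually_lt continuous_norm.continuousAt hxr] with y hy
        using hsupp y hy
    rw [this.fderiv_eq, hsupp x hxr]
    simp

/-- The divergence, divided by the weight, of the flux in the energy identity. -/
noncomputable def fluxDiv (A : EuclideanSpace ℝ (Fin N) → ℝ) (β t₀ σ θ : ℝ)
    (W : EuclideanSpace ℝ (Fin N) × ℝ → ℝ) (x : EuclideanSpace ℝ (Fin N)) (t : ℝ) : ℝ :=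
  2 * (∑ i, spaceDeriv i W (x, t) ^ 2)
  + 2 * θ * W (x, t) * (∑ i, spaceDeriv i W (x, t) *
      (β * fderiv ℝ A x (EuclideanSpace.single i 1) / (1 + t)))
  + 2 * W (x, t) * (∑ i, spaceDeriv i W (x, t) *
      (β * fderiv ℝ A x (EuclideanSpace.single i 1) / (1 + t)))
  + θ * W (x, t) ^ 2 * (∑ i, (β * fderiv ℝ A x (EuclideanSpace.single i 1) / (1 + t)) ^ 2)
  + 2 * W (x, t) * (∑ i, spaceDeriv i (spaceDeriv i W) (x, t))
  + θ * W (x, t) ^ 2 * (β * lap A x / (1 + t))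
  + 2 * σ * (t₀ + t) * (∑ i, spaceDeriv i W (x, t) * spaceDeriv i (timeDeriv W) (x, t))
  + 2 * σ * (t₀ + t) * timeDeriv W (x, t) *
    ((∑ i, spaceDeriv i W (x, t) * (β * fderiv ℝ A x (EuclideanSpace.single i 1) / (1 + t)))
      + ∑ i, spaceDeriv i (spaceDeriv i W) (x, t))

variable {Ω : Set (EuclideanSpace ℝ (Fin N))} {a A : EuclideanSpace ℝ (Fin N) → ℝ}
  {R β c t₀ σ θ : ℝ} {W : EuclideanSpace ℝ (Fin N) × ℝ → ℝ}

lemma setIntegral_fluxDiv_eq_zero (hΩ : IsOpen Ω) (hA : ContDiff ℝ 2 A)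
    (hW : IsDampedWave Ω a R W) {t τ : ℝ} (ht : 0 < t) (htτ : t ≤ τ) :
    ∫ x in Ω ∩ Metric.closedBall 0 (R + τ),
      expWeight A β c x t * fluxDiv A β t₀ σ θ W x t = 0 := by
  have slice : ∀ {U : EuclideanSpace ℝ (Fin N) × ℝ → ℝ}, ContDiff ℝ (⊤ : ℕ∞) U →
      ContDiff ℝ 1 fun y => U (y, t) := fun hU =>
    (hU.of_le (WithTop.coe_le_coe.2 (le_top (a := (1 : ℕ∞))))).comp
      (contDiff_id.prodMk contDiff_const)
  have hAd : ∀ i : Fin N, ContDiff ℝ 1 fun y => fderiv ℝ A y (EuclideanSpace.single i 1) :=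
    fun i => (hA.fderiv_right (m := 1) (by norm_num)).clm_apply contDiff_const
  have hψ : ∀ i : Fin N, ContDiff ℝ 1 fun y =>
      β * fderiv ℝ A y (EuclideanSpace.single i 1) / (1 + t) := fun i =>
    (contDiff_const.mul (hAd i)).div_const _
  have hψd : ∀ (i : Fin N) x, fderiv ℝ (fun y =>
      β * fderiv ℝ A y (EuclideanSpace.single i 1) / (1 + t)) x (EuclideanSpace.single i 1) =
      β * fderiv ℝ (fun y => fderiv ℝ A y (EuclideanSpace.single i 1)) x
        (EuclideanSpace.single i 1) / (1 + t) := by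
    intro i x
    have h1 := (((hAd i).differentiable one_ne_zero) x).hasFDerivAt.const_mul (β / (1 + t))
    have h2 : (fun y => β * fderiv ℝ A y (EuclideanSpace.single i 1) / (1 + t)) =
        fun y => β / (1 + t) * fderiv ℝ A y (EuclideanSpace.single i 1) := by
      funext y; ring
    rw [h2, h1.fderiv]
    simp only [smul_apply, smul_eq_mul]
    ring
  have hWs := slice hW.smooth
  have hYs : ∀ i, ContDiff ℝ 1 fun y => spaceDeriv i W (y, t) := fun i =>
    slice (hW.smooth.dirDeriv _)
  have hZs := slice hW.timeDeriv.smooth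
  have hΦ := contDiff_expWeight (β := β) (c := c) hA t
  have hdW : ∀ i x, fderiv ℝ (fun y => W (y, t)) x (EuclideanSpace.single i 1) =
      spaceDeriv i W (x, t) := fun i x =>
    fderiv_space ((hW.smooth.differentiable (by simp)) _) i
  have hdZ : ∀ i x, fderiv ℝ (fun y => timeDeriv W (y, t)) x (EuclideanSpace.single i 1) =
      spaceDeriv i (timeDeriv W) (x, t) := fun i x =>
    fderiv_space ((hW.timeDeriv.smooth.differentiable (by simp)) _) i
  have hdY : ∀ i x, fderiv ℝ (fun y => spaceDeriv i W (y, t)) x (EuclideanSpace.single i 1) =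
      spaceDeriv i (spaceDeriv i W) (x, t) := fun i x =>
    fderiv_space (((hW.smooth.dirDeriv _).differentiable (by simp)) _) i
  have h1c : ∀ i : Fin N, ContDiff ℝ 1 fun y => 2 * spaceDeriv i W (y, t) +
      θ * (W (y, t) * (β * fderiv ℝ A y (EuclideanSpace.single i 1) / (1 + t))) := fun i =>
    (contDiff_const.mul (hYs i)).add (contDiff_const.mul (hWs.mul (hψ i)))
  have h2c : ∀ i : Fin N, ContDiff ℝ 1 fun y => 2 * σ * (t₀ + t) * spaceDeriv i W (y, t) :=
    fun i => contDiff_const.mul (hYs i)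
  have I1 := setIntegral_div_eq_zero hΩ hWs (fun i => hΦ.mul (h1c i))
    (fun x hx => hW.bdry x hx t ht) (add_le_add_right htτ R) (fun x hx => hW.supp t ht x hx)
  have I2 := setIntegral_div_eq_zero hΩ hZs (fun i => hΦ.mul (h2c i))
    (fun x hx => hW.timeDeriv.bdry x hx t ht) (add_le_add_right htτ R)
    (fun x hx => hW.timeDeriv.supp t ht x hx)
  have hd1 : ∀ i x, fderiv ℝ (fun y => 2 * spaceDeriv i W (y, t) +
      θ * (W (y, t) * (β * fderiv ℝ A y (EuclideanSpace.single i 1) / (1 + t)))) x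
        (EuclideanSpace.single i 1) = 2 * spaceDeriv i (spaceDeriv i W) (x, t) +
      θ * (spaceDeriv i W (x, t) * (β * fderiv ℝ A x (EuclideanSpace.single i 1) / (1 + t)) +
        W (x, t) * (β * fderiv ℝ (fun y => fderiv ℝ A y (EuclideanSpace.single i 1)) x
        (EuclideanSpace.single i 1) / (1 + t))) := by
    intro i x
    have e1 := (((hYs i).differentiable one_ne_zero) x).hasFDerivAt
    have e2 := ((hWs.differentiable one_ne_zero) x).hasFDerivAt
    have e3 := (((hψ i).differentiable one_ne_zero) x).hasFDerivAt
    have e4 := (e1.const_mul 2).add ((e2.mul e3).const_mul θ)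
    have e5 : fderiv ℝ (fun y => 2 * spaceDeriv i W (y, t) +
      θ * (W (y, t) * (β * fderiv ℝ A y (EuclideanSpace.single i 1) / (1 + t)))) x = _ :=
      HasFDerivAt.fderiv e4
    rw [e5]
    simp only [add_apply, smul_apply, smul_eq_mul, hdW, hdY, hψd]
    ring
  have hd2 : ∀ i x, fderiv ℝ (fun y => 2 * σ * (t₀ + t) * spaceDeriv i W (y, t)) x
        (EuclideanSpace.single i 1) = 2 * σ * (t₀ + t) * spaceDeriv i (spaceDeriv i W) (x, t) := by
    intro i x
    have e1 := (((hYs i).differentiable one_ne_zero) x).hasFDerivAt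
    rw [(e1.const_mul (2 * σ * (t₀ + t))).fderiv]
    simp only [smul_apply, smul_eq_mul, hdY]
  simp only [fderiv_expWeight_mul hA (((h1c _).differentiable one_ne_zero) _), hdW, hd1] at I1
  simp only [fderiv_expWeight_mul hA (((h2c _).differentiable one_ne_zero) _), hdZ, hd2] at I2
  have hcW := hWs.continuous
  have hcZ := hZs.continuous
  have hcY := fun i => (hYs i).continuous
  have hcΦ := hΦ.continuous
  have hcψ := fun i => (hψ i).continuous
  have hcYY : ∀ i, Continuous fun y => spaceDeriv i (spaceDeriv i W) (y, t) := fun i =>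
    (slice ((hW.smooth.dirDeriv _).dirDeriv _)).continuous
  have hcYZ : ∀ i, Continuous fun y => spaceDeriv i (timeDeriv W) (y, t) := fun i =>
    (slice ((hW.smooth.dirDeriv _).dirDeriv _)).continuous
  have hcAA : ∀ i : Fin N, Continuous fun x =>
      fderiv ℝ (fun y => fderiv ℝ A y (EuclideanSpace.single i 1)) x
        (EuclideanSpace.single i 1) := fun i =>
    ((hAd i).continuous_fderiv one_ne_zero).clm_apply continuous_const
  have I := (integral_add (μ := volume.restrict (Ω ∩ Metric.closedBall 0 (R + τ)))
    (Continuous.integrableOn_of_subset_closedBall ?_ Set.inter_subset_right)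
    (Continuous.integrableOn_of_subset_closedBall ?_ Set.inter_subset_right)).trans
      (congrArg₂ (· + ·) I1 I2)
  · rw [add_zero] at I
    rw [← I]
    congr 1
    funext x
    rw [← Finset.sum_add_distrib]
    simp only [fluxDiv, lap, mul_add, Finset.mul_sum, Finset.sum_div, ← Finset.sum_add_distrib]
    refine Finset.sum_congr rfl fun i _ => ?_
    ring
  · refine continuous_finsetSum _ fun i _ => ?_
    exact ((hcY i).mul (hcΦ.mul (h1c i).continuous)).add (hcW.mul (hcΦ.mul
      (((hcψ i).mul (h1c i).continuous).add ((continuous_const.mul (hcYY i)).add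
        (continuous_const.mul (((hcY i).mul (hcψ i)).add
          (hcW.mul ((continuous_const.mul (hcAA i)).div_const _))))))))
  · refine continuous_finsetSum _ fun i _ => ?_
    exact ((hcYZ i).mul (hcΦ.mul (h2c i).continuous)).add (hcZ.mul (hcΦ.mul
      (((hcψ i).mul (h2c i).continuous).add (continuous_const.mul (hcYY i)))))

end Flux

section EnergyEstimate

variable {N : ℕ}

/-- The relations between the coefficients and the parameters which make the weighted energy
estimate work. -/
structure EnergyWeight (a A : EuclideanSpace ℝ (Fin N) → ℝ)
    (R β c t₀ σ η ν κ K m M : ℝ) : Prop where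
  cont : Continuous a
  pos : ∀ x, 0 < a x
  smooth : ContDiff ℝ 2 A
  poisson : ∀ x, lap A x = a x
  nonneg : ∀ x, 0 ≤ A x + c
  beta_pos : 0 < β
  one_le_t₀ : 1 ≤ t₀
  sigma_pos : 0 < σ
  eta_pos : 0 < η
  eta_le : 2 * η ≤ 1
  nu_pos : 0 < ν
  kappa_pos : 0 < κ
  K_nonneg : 0 ≤ K
  m_pos : 0 < m
  m_le : m ≤ M
  split : (1 - 2 * η) * β = m + κ
  sigma_le : σ * (1 + M) ≤ 2 * η
  grad : ∀ x, ∑ i, (β * fderiv ℝ A x (EuclideanSpace.single i 1)) ^ 2 ≤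
    (1 - ν) * a x * (β * (A x + c))
  weight_le : ∀ t ≥ (0 : ℝ), ∀ x, ‖x‖ ≤ R + t → β * (A x + c) / (1 + t) ^ 2 ≤ K * a x
  damping_large : ∀ t ≥ (0 : ℝ), ∀ x, ‖x‖ ≤ R + t →
    K / ν + 2 + σ * (1 + M) + M ^ 2 / κ ≤ σ / 2 * ((t₀ + t) * a x)
  one_le_damping : ∀ t ≥ (0 : ℝ), ∀ x, ‖x‖ ≤ R + t → 1 ≤ (t₀ + t) * a x

variable {Ω : Set (EuclideanSpace ℝ (Fin N))} {a A : EuclideanSpace ℝ (Fin N) → ℝ}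
  {R β c t₀ σ η ν κ K m M : ℝ} {W : EuclideanSpace ℝ (Fin N) × ℝ → ℝ}

lemma energyDensityDeriv_sub_fluxDiv_le (hw : EnergyWeight a A R β c t₀ σ η ν κ K m M)
    (hW : IsDampedWave Ω a R W) {p t : ℝ} (hp : 0 ≤ p) (hpM : p ≤ M) (ht : 0 < t)
    {x : EuclideanSpace ℝ (Fin N)} (hx : x ∈ Ω) :
    energyDensityDeriv a A β c t₀ σ W x t
      - expWeight A β c x t * fluxDiv A β t₀ σ (1 - 2 * η) W x t
      + p / (t₀ + t) * energyDensity a A β c t₀ σ W x t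
    ≤ (p - m) / (t₀ + t) * (expWeight A β c x t * (a x * W (x, t) ^ 2))
      - σ / 2 * (t₀ + t) * (expWeight A β c x t * (a x * timeDeriv W (x, t) ^ 2)) := by
  rcases le_or_gt ‖x‖ (R + t) with hxt | hxt
  · have ht1 : 0 < 1 + t := by linarith
    have hT : 0 < t₀ + t := by linarith [hw.one_le_t₀]
    have hlam : 0 ≤ β * (A x + c) / (1 + t) ^ 2 :=
      div_nonneg (mul_nonneg hw.beta_pos.le (hw.nonneg x)) (by positivity)
    have hcs := Finset.sum_mul_sq_le_sq_mul_sq Finset.univ (fun i => spaceDeriv i W (x, t))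
      fun i => β * fderiv ℝ A x (EuclideanSpace.single i 1) / (1 + t)
    have hsq : 0 ≤ (∑ i, spaceDeriv i W (x, t) ^ 2) + 2 * W (x, t) * (∑ i, spaceDeriv i W (x, t) *
        (β * fderiv ℝ A x (EuclideanSpace.single i 1) / (1 + t))) + W (x, t) ^ 2 *
        ∑ i, (β * fderiv ℝ A x (EuclideanSpace.single i 1) / (1 + t)) ^ 2 := by
      have : (∑ i, spaceDeriv i W (x, t) ^ 2) + 2 * W (x, t) * (∑ i, spaceDeriv i W (x, t) *
          (β * fderiv ℝ A x (EuclideanSpace.single i 1) / (1 + t))) + W (x, t) ^ 2 *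
          ∑ i, (β * fderiv ℝ A x (EuclideanSpace.single i 1) / (1 + t)) ^ 2 =
          ∑ i, (spaceDeriv i W (x, t) +
            W (x, t) * (β * fderiv ℝ A x (EuclideanSpace.single i 1) / (1 + t))) ^ 2 := by
        simp only [Finset.mul_sum, ← Finset.sum_add_distrib]
        exact Finset.sum_congr rfl fun i _ => by ring
      rw [this]
      positivity
    have hq : ∑ i, (β * fderiv ℝ A x (EuclideanSpace.single i 1) / (1 + t)) ^ 2 ≤
        (1 - ν) * a x * (β * (A x + c) / (1 + t) ^ 2) := by
      simp only [div_pow, ← Finset.sum_div]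
      rw [← mul_div_assoc]
      gcongr
      exact hw.grad x
    have hD : β * a x / (t₀ + t) ≤ β * lap A x / (1 + t) := by
      rw [hw.poisson]
      have := hw.one_le_t₀
      have := hw.pos x
      have := hw.beta_pos
      gcongr
    have key := energy_integrand_le (L := ∑ i, spaceDeriv i (spaceDeriv i W) (x, t))
      (r := ∑ i, spaceDeriv i W (x, t) * spaceDeriv i (timeDeriv W) (x, t))
      (Z := timeDeriv W (x, t)) (hw.pos x) hT hlam
      (Finset.sum_nonneg fun i _ => sq_nonneg (spaceDeriv i W (x, t))) hcs hsq hq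
      (hw.weight_le t ht.le x hxt) hD hw.eta_pos hw.eta_le hw.nu_pos hw.kappa_pos hw.sigma_pos
      hw.split hw.sigma_le (hw.damping_large t ht.le x hxt) (hw.one_le_damping t ht.le x hxt)
      hp hpM
    have key2 := mul_le_mul_of_nonneg_left key (expWeight_pos (A := A) (β := β) (c := c) x t).le
    simp only [energyDensityDeriv, energyDensity, fluxDiv, hW.eqn x hx t ht]
    refine le_trans (le_of_eq ?_) (key2.trans (le_of_eq ?_)) <;> ring
  · have h1 := hW.supp_zero ht.le hxt
    have h2 := hW.timeDeriv.supp_zero ht.le hxt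
    have h3 := hW.spaceDeriv_supp ht.le hxt
    simp [energyDensityDeriv, energyDensity, fluxDiv, h1, h2, h3]

/-- The energy density controls the weighted solution and its gradient. -/
lemma le_energyDensity (hw : EnergyWeight a A R β c t₀ σ η ν κ K m M)
    (hW : IsDampedWave Ω a R W) {t : ℝ} (ht : 0 ≤ t) (x : EuclideanSpace ℝ (Fin N)) :
    expWeight A β c x t * (1 / 2 * (a x * W (x, t) ^ 2)
      + σ / 2 * (t₀ + t) * ∑ i, spaceDeriv i W (x, t) ^ 2) ≤ energyDensity a A β c t₀ σ W x t := by
  rcases le_or_gt ‖x‖ (R + t) with hxt | hxt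
  · have hT : 0 < t₀ + t := by linarith [hw.one_le_t₀]
    refine mul_le_mul_of_nonneg_left ?_ (expWeight_pos x t).le
    have ha := hw.pos x
    have hσ := hw.sigma_pos
    have hP : 0 ≤ ∑ i, spaceDeriv i W (x, t) ^ 2 := Finset.sum_nonneg fun i _ => sq_nonneg _
    have h1 := hw.damping_large t ht x hxt
    have h2 : 0 ≤ K / ν := div_nonneg hw.K_nonneg hw.nu_pos.le
    have h3 : 0 ≤ M ^ 2 / κ := div_nonneg (sq_nonneg _) hw.kappa_pos.le
    have h4 : 0 ≤ σ * (1 + M) := mul_nonneg hσ.le (by linarith [hw.m_pos, hw.m_le])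
    have h5 : 2 ≤ σ * (t₀ + t) * a x := by linarith
    have h6 : 0 ≤ (a x * W (x, t) + 2 * timeDeriv W (x, t)) ^ 2 / (2 * a x) := by positivity
    have h7 : (a x * W (x, t) + 2 * timeDeriv W (x, t)) ^ 2 / (2 * a x) =
        1 / 2 * (a x * W (x, t) ^ 2) + 2 * W (x, t) * timeDeriv W (x, t) +
          2 / a x * timeDeriv W (x, t) ^ 2 := by
      field_simp
      ring
    have h8 : 2 / a x ≤ σ * (t₀ + t) := by
      rw [div_le_iff₀ ha]; exact h5
    have h9 := mul_le_mul_of_nonneg_right h8 (sq_nonneg (timeDeriv W (x, t)))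
    have h10 : 0 ≤ σ / 2 * (t₀ + t) * ∑ i, spaceDeriv i W (x, t) ^ 2 := by positivity
    linarith
  · have h1 := hW.supp_zero ht hxt
    have h3 := hW.spaceDeriv_supp ht hxt
    have h2 := hW.timeDeriv.supp_zero ht hxt
    simp [energyDensity, h1, h2, h3]

lemma continuous_energyDensity (hw : EnergyWeight a A R β c t₀ σ η ν κ K m M)
    (hW : IsDampedWave Ω a R W) {t : ℝ} (ht : 0 ≤ t) :
    Continuous fun x => energyDensity a A β c t₀ σ W x t :=
  (continuousOn_energyDensity hw.cont hw.smooth.continuous hW.smooth).comp_continuous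
    (f := fun x : EuclideanSpace ℝ (Fin N) => (x, t)) (by fun_prop)
    fun x => ⟨mem_univ _, show (-1 : ℝ) < t by linarith⟩

lemma continuous_expWeight (hw : EnergyWeight a A R β c t₀ σ η ν κ K m M) (t : ℝ) :
    Continuous fun x => expWeight A β c x t :=
  (contDiff_expWeight hw.smooth t).continuous

/-- The differential inequality for the weighted energy. -/
lemma setIntegral_energyDensityDeriv_le (hΩ : IsOpen Ω)
    (hw : EnergyWeight a A R β c t₀ σ η ν κ K m M) (hW : IsDampedWave Ω a R W)
    {p t τ : ℝ} (hp : 0 ≤ p) (hpM : p ≤ M) (ht : 0 < t) (htτ : t ≤ τ) :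
    (∫ x in Ω ∩ Metric.closedBall 0 (R + τ), energyDensityDeriv a A β c t₀ σ W x t)
      + p / (t₀ + t) * ∫ x in Ω ∩ Metric.closedBall 0 (R + τ), energyDensity a A β c t₀ σ W x t
    ≤ (p - m) / (t₀ + t) * (∫ x in Ω ∩ Metric.closedBall 0 (R + τ),
        expWeight A β c x t * (a x * W (x, t) ^ 2))
      - σ / 2 * (t₀ + t) * ∫ x in Ω ∩ Metric.closedBall 0 (R + τ),
        expWeight A β c x t * (a x * timeDeriv W (x, t) ^ 2) := by
  have hI : ∀ {f : EuclideanSpace ℝ (Fin N) → ℝ}, Continuous f →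
      IntegrableOn f (Ω ∩ Metric.closedBall 0 (R + τ)) := fun hf =>
    hf.integrableOn_of_subset_closedBall Set.inter_subset_right
  have c1 : Continuous fun x => energyDensityDeriv a A β c t₀ σ W x t :=
    (continuousOn_energyDensityDeriv hw.cont hw.smooth.continuous hW.smooth).comp_continuous
      (f := fun x : EuclideanSpace ℝ (Fin N) => (x, t)) (by fun_prop)
      fun x => ⟨mem_univ _, show (-1 : ℝ) < t by linarith⟩
  have c2 := continuous_energyDensity hw hW ht.le
  have hcΦ := continuous_expWeight hw t
  have ca := hw.cont
  have cW := hW.smooth.continuous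
  have cZ := hW.timeDeriv.smooth.continuous
  have c3 : Continuous fun x => expWeight A β c x t * (a x * W (x, t) ^ 2) := by fun_prop
  have c4 : Continuous fun x => expWeight A β c x t * (a x * timeDeriv W (x, t) ^ 2) := by
    fun_prop
  have c5 : Continuous fun x => expWeight A β c x t * fluxDiv A β t₀ σ (1 - 2 * η) W x t := by
    have hcY : ∀ i, Continuous (spaceDeriv i W) := fun i => (hW.smooth.dirDeriv _).continuous
    have hcYY : ∀ i, Continuous (spaceDeriv i (spaceDeriv i W)) := fun i =>
      ((hW.smooth.dirDeriv _).dirDeriv _).continuous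
    have hcYZ : ∀ i, Continuous (spaceDeriv i (timeDeriv W)) := fun i =>
      ((hW.smooth.dirDeriv _).dirDeriv _).continuous
    have hcA : ∀ i : Fin N, Continuous fun x => fderiv ℝ A x (EuclideanSpace.single i 1) :=
      fun i => (hw.smooth.continuous_fderiv two_ne_zero).clm_apply continuous_const
    simp only [fluxDiv, hw.poisson, div_eq_mul_inv]
    fun_prop
  have e1 := setIntegral_fluxDiv_eq_zero (β := β) (c := c) (t₀ := t₀) (σ := σ)
    (θ := 1 - 2 * η) hΩ hw.smooth hW ht htτ
  have hle : ∫ x in Ω ∩ Metric.closedBall 0 (R + τ), (energyDensityDeriv a A β c t₀ σ W x t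
      - expWeight A β c x t * fluxDiv A β t₀ σ (1 - 2 * η) W x t
      + p / (t₀ + t) * energyDensity a A β c t₀ σ W x t) ≤
      ∫ x in Ω ∩ Metric.closedBall 0 (R + τ),
        ((p - m) / (t₀ + t) * (expWeight A β c x t * (a x * W (x, t) ^ 2))
      - σ / 2 * (t₀ + t) * (expWeight A β c x t * (a x * timeDeriv W (x, t) ^ 2))) := by
    refine setIntegral_mono_on (hI (by fun_prop)) (hI (by fun_prop))
      (hΩ.measurableSet.inter Metric.isClosed_closedBall.measurableSet) fun x hx => ?_
    exact energyDensityDeriv_sub_fluxDiv_le hw hW hp hpM ht hx.1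
  have c6 : Continuous fun x => energyDensityDeriv a A β c t₀ σ W x t
      - expWeight A β c x t * fluxDiv A β t₀ σ (1 - 2 * η) W x t := c1.sub c5
  have c7 : Continuous fun x => p / (t₀ + t) * energyDensity a A β c t₀ σ W x t :=
    continuous_const.mul c2
  have c8 : Continuous fun x =>
      (p - m) / (t₀ + t) * (expWeight A β c x t * (a x * W (x, t) ^ 2)) := continuous_const.mul c3
  have c9 : Continuous fun x =>
      σ / 2 * (t₀ + t) * (expWeight A β c x t * (a x * timeDeriv W (x, t) ^ 2)) :=
    continuous_const.mul c4
  rwa [integral_add (hI c6) (hI c7), integral_sub (hI c1) (hI c5), e1,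
    integral_sub (hI c8) (hI c9), integral_const_mul, integral_const_mul, integral_const_mul,
    sub_zero] at hle

end EnergyEstimate

section Hierarchy

/-- A telescoping Grönwall argument for a finite hierarchy of differential inequalities. -/
lemma sum_mul_rpow_mul_le {E E' I : ℕ → ℝ → ℝ} {m σ μ t₀ τ : ℝ} {k : ℕ} (ht₀ : 0 < t₀)
    (hτ : 0 ≤ τ) (hμ : 0 ≤ μ) (hσ : 0 ≤ σ) (hμσ : μ * (2 * (k + 1)) ≤ σ / 2)
    (hd : ∀ j, ∀ t > (-1 : ℝ), HasDerivAt (E j) (E' j t) t)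
    (hI : ∀ j t, 0 ≤ I j t)
    (hle : ∀ j ≤ k, ∀ t ∈ Ioo 0 τ, E' j t + (m + 2 * j) / (t₀ + t) * E j t ≤
      2 * j / (t₀ + t) * I j t - σ / 2 * (t₀ + t) * I (j + 1) t) :
    ∑ j ∈ Finset.range (k + 1), μ ^ j * ((t₀ + τ) ^ (m + 2 * j : ℝ) * E j τ) ≤
      ∑ j ∈ Finset.range (k + 1), μ ^ j * (t₀ ^ (m + 2 * j : ℝ) * E j 0) := by
  have hderiv : ∀ t ≥ (0 : ℝ), HasDerivAt
      (fun t => ∑ j ∈ Finset.range (k + 1), μ ^ j * ((t₀ + t) ^ (m + 2 * j : ℝ) * E j t))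
      (∑ j ∈ Finset.range (k + 1), μ ^ j * ((t₀ + t) ^ (m + 2 * j : ℝ) *
        (E' j t + (m + 2 * j) / (t₀ + t) * E j t))) t := by
    intro t ht
    have hT : 0 < t₀ + t := by linarith
    refine HasDerivAt.fun_sum fun j _ => HasDerivAt.const_mul _ ?_
    have h1 := ((hasDerivAt_id t).const_add t₀).rpow_const (p := m + 2 * j) (Or.inl hT.ne')
    refine (h1.mul (hd j t (by linarith))).congr_deriv ?_
    simp only [id_eq]
    rw [rpow_sub_one hT.ne']
    field_simp
    ring
  have hnonpos : ∀ t ∈ Ioo 0 τ, ∀ n ≤ k, ∑ j ∈ Finset.range (n + 1), μ ^ j *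
      ((t₀ + t) ^ (m + 2 * j : ℝ) * (E' j t + (m + 2 * j) / (t₀ + t) * E j t)) ≤
      -(μ ^ n * ((t₀ + t) ^ (m + 2 * n : ℝ) * (σ / 2 * (t₀ + t) * I (n + 1) t))) := by
    intro t ht n
    have hT : 0 < t₀ + t := by linarith [ht.1]
    induction n with
    | zero =>
      intro hn
      have h1 := hle 0 hn t ht
      have h2 := mul_le_mul_of_nonneg_left h1 (rpow_nonneg hT.le (m + 2 * (0 : ℕ)))
      simp only [zero_add, Finset.sum_range_one, pow_zero, one_mul]
      refine h2.trans (le_of_eq ?_)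
      push_cast
      ring
    | succ n ih =>
      intro hn
      rw [Finset.sum_range_succ]
      have h1 := ih (by omega)
      have h2 := mul_le_mul_of_nonneg_left (mul_le_mul_of_nonneg_left (hle (n + 1) hn t ht)
        (rpow_nonneg hT.le (m + 2 * (n + 1 : ℕ)))) (pow_nonneg hμ (n + 1))
      have h3 : (t₀ + t) ^ (m + 2 * (n + 1 : ℕ) : ℝ) =
          (t₀ + t) ^ (m + 2 * n : ℝ) * (t₀ + t) ^ 2 := by
        rw [← rpow_natCast, ← rpow_add hT]
        push_cast
        ring_nf
      have h4 : μ * (2 * ((n : ℝ) + 1)) ≤ σ / 2 := by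
        refine le_trans ?_ hμσ
        have : (n : ℝ) ≤ k := by exact_mod_cast (by omega : n ≤ k)
        gcongr
      have h5 := mul_le_mul_of_nonneg_right h4
        (mul_nonneg (mul_nonneg (pow_nonneg hμ n) (rpow_nonneg hT.le (m + 2 * n)))
          (mul_nonneg hT.le (hI (n + 1) t)))
      have h6 : μ ^ (n + 1) * ((t₀ + t) ^ (m + 2 * (n + 1 : ℕ) : ℝ) *
          (2 * (n + 1 : ℕ) / (t₀ + t) * I (n + 1) t)) = μ * (2 * ((n : ℝ) + 1)) *
          (μ ^ n * (t₀ + t) ^ (m + 2 * n : ℝ) * ((t₀ + t) * I (n + 1) t)) := by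
        rw [h3]
        push_cast
        field_simp
        ring
      rw [mul_sub, mul_sub, h6] at h2
      linarith
  have hanti : AntitoneOn
      (fun t => ∑ j ∈ Finset.range (k + 1), μ ^ j * ((t₀ + t) ^ (m + 2 * j : ℝ) * E j t))
      (Icc 0 τ) := by
    refine antitoneOn_of_hasDerivWithinAt_nonpos (convex_Icc 0 τ)
      (fun t ht => (hderiv t ht.1).continuousAt.continuousWithinAt)
      (fun t ht => (hderiv t (interior_subset ht).1).hasDerivWithinAt) fun t ht => ?_
    rw [interior_Icc] at ht
    refine (hnonpos t ht k le_rfl).trans (neg_nonpos.2 ?_)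
    have hT : 0 < t₀ + t := by linarith [ht.1]
    have := hI (k + 1) t
    positivity
  simpa using hanti ⟨le_rfl, hτ⟩ ⟨hτ, le_rfl⟩ hτ

variable {N : ℕ} {Ω : Set (EuclideanSpace ℝ (Fin N))} {a A : EuclideanSpace ℝ (Fin N) → ℝ}
  {R β c t₀ σ η ν κ K m M : ℝ} {W : EuclideanSpace ℝ (Fin N) × ℝ → ℝ}

/-- Weighted energy decay for the time derivatives of a damped wave, in terms of the initial
energies. -/
lemma energy_decay {k : ℕ} (hΩ : IsOpen Ω)
    (hw : EnergyWeight a A R β c t₀ σ η ν κ K m (m + 2 * k)) (hW : IsDampedWave Ω a R W)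
    {μ τ : ℝ} (hμ : 0 < μ) (hμσ : μ * (2 * (k + 1)) ≤ σ / 2) (hτ : 0 ≤ τ) :
    μ ^ k * ((t₀ + τ) ^ (m + 2 * k : ℝ) *
      (1 / 2 * (∫ x in Ω ∩ Metric.closedBall 0 (R + τ),
          expWeight A β c x τ * (a x * timeDeriv^[k] W (x, τ) ^ 2))
        + σ / 2 * (t₀ + τ) * ∫ x in Ω ∩ Metric.closedBall 0 (R + τ),
          expWeight A β c x τ * ∑ i, spaceDeriv i (timeDeriv^[k] W) (x, τ) ^ 2)) ≤
      ∑ j ∈ Finset.range (k + 1), μ ^ j * (t₀ ^ (m + 2 * j : ℝ) *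
        ∫ x in Ω ∩ Metric.closedBall 0 (R + τ),
          energyDensity a A β c t₀ σ (timeDeriv^[j] W) x 0) := by
  have hSm : MeasurableSet (Ω ∩ Metric.closedBall 0 (R + τ)) :=
    hΩ.measurableSet.inter Metric.isClosed_closedBall.measurableSet
  have hI : ∀ {f : EuclideanSpace ℝ (Fin N) → ℝ}, Continuous f →
      IntegrableOn f (Ω ∩ Metric.closedBall 0 (R + τ)) := fun hf =>
    hf.integrableOn_of_subset_closedBall Set.inter_subset_right
  have hWj := fun j => hW.iterate_timeDeriv j
  have ht₀ : 0 < t₀ := by linarith [hw.one_le_t₀]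
  have hT : 0 < t₀ + τ := by linarith
  have hσ := hw.sigma_pos
  have hm := hw.m_pos
  have main := sum_mul_rpow_mul_le (m := m) (k := k)
    (E := fun j t => ∫ x in Ω ∩ Metric.closedBall 0 (R + τ),
      energyDensity a A β c t₀ σ (timeDeriv^[j] W) x t)
    (E' := fun j t => ∫ x in Ω ∩ Metric.closedBall 0 (R + τ),
      energyDensityDeriv a A β c t₀ σ (timeDeriv^[j] W) x t)
    (I := fun j t => ∫ x in Ω ∩ Metric.closedBall 0 (R + τ),
      expWeight A β c x t * (a x * timeDeriv^[j] W (x, t) ^ 2))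
    ht₀ hτ hμ.le hσ.le hμσ
    (fun j t ht => hasDerivAt_setIntegral_of_continuousOn hSm Set.inter_subset_right
      (continuousOn_energyDensity hw.cont hw.smooth.continuous (hWj j).smooth)
      (continuousOn_energyDensityDeriv hw.cont hw.smooth.continuous (hWj j).smooth)
      (fun x t ht => hasDerivAt_energyDensity (hWj j).smooth x ht) ht)
    (fun j t => integral_nonneg fun x =>
      mul_nonneg (expWeight_pos x t).le (mul_nonneg (hw.pos x).le (sq_nonneg _)))
    (fun j hj t ht => by
      have hjk : (j : ℝ) ≤ k := by exact_mod_cast hj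
      have := setIntegral_energyDensityDeriv_le (p := m + 2 * j) hΩ hw (hWj j) (by positivity)
        (by linarith) ht.1 ht.2.le
      rw [add_sub_cancel_left] at this
      rw [Function.iterate_succ_apply']
      exact this)
  refine le_trans ?_ main
  have hcΦ := continuous_expWeight hw τ
  have ca := hw.cont
  have cW := (hWj k).smooth.continuous
  have cY : ∀ i, Continuous (spaceDeriv i (timeDeriv^[k] W)) := fun i =>
    ((hWj k).smooth.dirDeriv _).continuous
  have c1 : Continuous fun x => 1 / 2 * (expWeight A β c x τ *
    (a x * timeDeriv^[k] W (x, τ) ^ 2)) := by fun_prop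
  have c2 : Continuous fun x => σ / 2 * (t₀ + τ) * (expWeight A β c x τ *
    ∑ i, spaceDeriv i (timeDeriv^[k] W) (x, τ) ^ 2) := by fun_prop
  have hnn : ∀ j, 0 ≤ ∫ x in Ω ∩ Metric.closedBall 0 (R + τ),
      energyDensity a A β c t₀ σ (timeDeriv^[j] W) x τ := by
    intro j
    refine integral_nonneg fun x => le_trans ?_ (le_energyDensity hw (hWj j) hτ x)
    have h1 := expWeight_pos (A := A) (β := β) (c := c) x τ
    have h2 := hw.pos x
    positivity
  have hlow : 1 / 2 * (∫ x in Ω ∩ Metric.closedBall 0 (R + τ),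
        expWeight A β c x τ * (a x * timeDeriv^[k] W (x, τ) ^ 2))
      + σ / 2 * (t₀ + τ) * (∫ x in Ω ∩ Metric.closedBall 0 (R + τ),
        expWeight A β c x τ * ∑ i, spaceDeriv i (timeDeriv^[k] W) (x, τ) ^ 2) ≤
      ∫ x in Ω ∩ Metric.closedBall 0 (R + τ),
        energyDensity a A β c t₀ σ (timeDeriv^[k] W) x τ := by
    rw [← integral_const_mul, ← integral_const_mul, ← integral_add (hI c1) (hI c2)]
    refine setIntegral_mono_on (hI (c1.add c2)) (hI (continuous_energyDensity hw (hWj k) hτ)) hSm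
      fun x _ => le_trans (le_of_eq ?_) (le_energyDensity hw (hWj k) hτ x)
    ring
  refine le_trans ?_ (Finset.single_le_sum (f := fun j : ℕ => μ ^ j *
    ((t₀ + τ) ^ (m + 2 * j : ℝ) * ∫ x in Ω ∩ Metric.closedBall 0 (R + τ),
      energyDensity a A β c t₀ σ (timeDeriv^[j] W) x τ)) (fun j _ => ?_)
    (Finset.self_mem_range_succ k))
  · gcongr
  · have := hnn j
    positivity

end Hierarchy

section Parameters

variable {N : ℕ}

/-- Suitable parameters satisfy the structural hypotheses of the energy estimate, for every
decay rate `m < 1 / h`. -/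
lemma exists_energyWeight {a A : EuclideanSpace ℝ (Fin N) → ℝ} (ha : Continuous a)
    (ha_pos : ∀ x, 0 < a x) {a₁ α : ℝ} (ha₁ : 0 < a₁) (hα : 0 ≤ α) (hα1 : α < 1)
    (ha_bd : ∀ x, a₁ * (1 + ‖x‖) ^ (-α) ≤ a x) (hA : ContDiff ℝ 2 A)
    (hPoisson : ∀ x, lap A x = a x) {A₂ : ℝ} (hA_pos : ∀ x, 0 ≤ A x)
    (hA_bd : ∀ x, A x ≤ A₂ * (1 + ‖x‖) ^ (2 - α)) {h : ℝ} (hh : 0 < h)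
    (hgrad : ∀ δ > (0 : ℝ), ∃ R > (0 : ℝ), ∀ x, R ≤ ‖x‖ →
      ‖gradient A x‖ ^ 2 ≤ (h + δ) * a x * A x)
    {R₀ : ℝ} (hR₀ : 0 < R₀) {m M : ℝ} (hm : 0 < m) (hmh : m < 1 / h) (hmM : m ≤ M) :
    ∃ β c t₀ σ η ν κ K : ℝ, 0 ≤ c ∧ EnergyWeight a A R₀ β c t₀ σ η ν κ K m M := by
  obtain ⟨β, hmβ, hβh⟩ := exists_between hmh
  have hβ : 0 < β := hm.trans hmβ
  have hβh1 : β * h < 1 := (lt_div_iff₀ hh).1 hβh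
  have hδ : 0 < (1 - β * h) / (2 * β) := div_pos (by linarith) (by linarith)
  obtain ⟨r, -, hr⟩ := hgrad _ hδ
  set δ := (1 - β * h) / (2 * β) with hδ_def
  have hβδ : β * (h + δ) = 1 - (1 - β * h) / 2 := by
    rw [hδ_def]; field_simp; ring
  have hgc : Continuous fun x => ∑ i, (fderiv ℝ A x (EuclideanSpace.single i 1)) ^ 2 :=
    continuous_finsetSum _ fun i _ =>
      ((hA.continuous_fderiv two_ne_zero).clm_apply continuous_const).pow 2
  simp only [sum_sq_eq_norm_gradient_sq] at hr
  obtain ⟨B, hB⟩ :=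
    (isCompact_closedBall (0 : EuclideanSpace ℝ (Fin N)) r).exists_bound_of_continuousOn
    (hgc.div ha fun x => (ha_pos x).ne').continuousOn
  obtain ⟨c, hc, hcB⟩ : ∃ c, 0 ≤ c ∧ B ≤ (h + δ) * c := by
    refine ⟨max B 0 / (h + δ), by positivity, ?_⟩
    rw [mul_div_cancel₀ _ (by positivity)]
    exact le_max_left _ _
  have hgrad' : ∀ x, ∑ i, (fderiv ℝ A x (EuclideanSpace.single i 1)) ^ 2 ≤
      (h + δ) * a x * (A x + c) := by
    intro x
    have hax := ha_pos x
    have hAx := hA_pos x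
    rcases le_or_gt r ‖x‖ with hx | hx
    · have : 0 ≤ (h + δ) * a x * c := by positivity
      linarith [hr x hx]
    · have h1 := (le_abs_self _).trans (hB x (by simpa using hx.le))
      rw [Pi.div_apply, div_le_iff₀ hax] at h1
      have h2 := mul_le_mul_of_nonneg_right hcB hax.le
      have : 0 ≤ (h + δ) * a x * A x := by positivity
      linarith
  have hA₂ : 0 ≤ A₂ := by
    have := (hA_pos 0).trans (hA_bd 0)
    simpa using this
  have hM : 0 < 1 + M := by linarith
  set η := (β - m) / (4 * β) with hη_def
  have hη : 0 < η := div_pos (by linarith) (by linarith)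
  have hσ : 0 < 2 * η / (1 + M) := by positivity
  set σ := 2 * η / (1 + M) with hσ_def
  set ν := (1 - β * h) / 2 with hν_def
  have hν : 0 < ν := by rw [hν_def]; linarith
  set K := β * (A₂ + c) / a₁ * (1 + R₀) ^ 2 with hK_def
  set Q := K / ν + 2 + σ * (1 + M) + M ^ 2 / ((β - m) / 2) with hQ_def
  obtain ⟨t₀, ht₀, hQt, h1t⟩ : ∃ t₀, 1 + R₀ ≤ t₀ ∧ 2 / σ * Q ≤ a₁ * t₀ ^ (1 - α) ∧
      1 ≤ a₁ * t₀ ^ (1 - α) := by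
    have hlim : Tendsto (fun t : ℝ => a₁ * t ^ (1 - α)) atTop atTop :=
      (tendsto_rpow_atTop (by linarith)).const_mul_atTop ha₁
    exact ((eventually_ge_atTop _).and ((hlim.eventually_ge_atTop _).and
      (hlim.eventually_ge_atTop _))).exists
  have hdamp : ∀ t ≥ (0 : ℝ), ∀ x : EuclideanSpace ℝ (Fin N), ‖x‖ ≤ R₀ + t →
      a₁ * t₀ ^ (1 - α) ≤ (t₀ + t) * a x := by
    intro t ht x hx
    have hT : 0 < t₀ + t := by linarith
    calc a₁ * t₀ ^ (1 - α) ≤ a₁ * (t₀ + t) ^ (1 - α) := by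
          have : 0 ≤ 1 - α := by linarith
          have : 0 ≤ t₀ := by linarith
          gcongr
          linarith
      _ = (t₀ + t) * (a₁ * (t₀ + t) ^ (-α)) := by
          rw [sub_eq_add_neg, rpow_add hT, rpow_one]; ring
      _ ≤ (t₀ + t) * (a₁ * (1 + ‖x‖) ^ (-α)) := by
          have := rpow_le_rpow_of_nonpos (show 0 < 1 + ‖x‖ by positivity)
            (show 1 + ‖x‖ ≤ t₀ + t by linarith) (neg_nonpos.2 hα)
          gcongr
      _ ≤ (t₀ + t) * a x := by gcongr; exact ha_bd x
  refine ⟨β, c, t₀, σ, η, ν, (β - m) / 2, K, hc, ha, ha_pos, hA, hPoisson,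
    fun x => add_nonneg (hA_pos x) hc, hβ, by linarith, hσ, hη, ?_, hν, by linarith,
    by positivity, hm, hmM, ?_, ?_, fun x => ?_, fun t ht x hx => ?_, fun t ht x hx => ?_,
    fun t ht x hx => h1t.trans (hdamp t ht x hx)⟩
  · rw [hη_def, ← mul_div_assoc, div_le_one (by positivity)]
    linarith
  · rw [hη_def]; field_simp; ring
  · rw [hσ_def, div_mul_cancel₀ _ hM.ne']
  · simp only [mul_pow, ← Finset.mul_sum]
    calc _ ≤ β ^ 2 * ((h + δ) * a x * (A x + c)) :=
          mul_le_mul_of_nonneg_left (hgrad' x) (sq_nonneg _)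
      _ = (β * (h + δ)) * a x * (β * (A x + c)) := by ring
      _ = _ := by rw [hβδ]
  · rw [div_le_iff₀ (by positivity)]
    have hx1 : 1 ≤ 1 + ‖x‖ := by linarith [norm_nonneg x]
    have hx0 : 0 < 1 + ‖x‖ := by linarith
    have h1 : A x + c ≤ (A₂ + c) * (1 + ‖x‖) ^ (2 - α) := by
      have h2 : 1 ≤ (1 + ‖x‖) ^ (2 - α) := one_le_rpow hx1 (by linarith)
      linarith [hA_bd x, mul_le_mul_of_nonneg_left h2 hc]
    have h2 : (1 + ‖x‖) ^ (2 - α) = (1 + ‖x‖) ^ 2 * (1 + ‖x‖) ^ (-α) := by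
      rw [sub_eq_add_neg, rpow_add hx0]; norm_cast
    have h3 : (1 + ‖x‖) ^ (-α) ≤ a x / a₁ := by
      rw [le_div_iff₀ ha₁]; linarith [ha_bd x]
    have h4 : (1 + ‖x‖) ^ 2 ≤ ((1 + R₀) * (1 + t)) ^ 2 := by
      gcongr
      linarith [mul_nonneg hR₀.le ht]
    calc β * (A x + c) ≤ β * ((A₂ + c) * (((1 + R₀) * (1 + t)) ^ 2 * (a x / a₁))) := by
          refine mul_le_mul_of_nonneg_left (h1.trans ?_) hβ.le
          rw [h2]
          gcongr
      _ = K * a x * (1 + t) ^ 2 := by rw [hK_def]; field_simp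
  · have h1 := hQt.trans (hdamp t ht x hx)
    have h2 := mul_le_mul_of_nonneg_left h1 (show 0 ≤ σ / 2 by positivity)
    have h3 : σ / 2 * (2 / σ * Q) = Q := by field_simp
    rwa [h3] at h2

end Parameters

section InitialData

lemma norm_iteratedFDeriv_fderiv_apply_le {E F : Type*} [NormedAddCommGroup E] [NormedSpace ℝ E]
    [NormedAddCommGroup F] [NormedSpace ℝ F] {f : E → F} (hf : ContDiff ℝ (⊤ : ℕ∞) f) (n : ℕ)
    (v x : E) :
    ‖iteratedFDeriv ℝ n (fun y => fderiv ℝ f y v) x‖ ≤ ‖v‖ * ‖iteratedFDeriv ℝ (n + 1) f x‖ := by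
  have h1 : ContDiff ℝ (⊤ : ℕ∞) (fderiv ℝ f) :=
    hf.fderiv_right (m := ((⊤ : ℕ∞) : WithTop ℕ∞)) (by simp)
  rw [← norm_iteratedFDeriv_fderiv]
  exact norm_iteratedFDeriv_clm_apply_const h1.contDiffAt
    (WithTop.coe_le_coe.2 (le_top (a := (n : ℕ∞))))

variable {N : ℕ} {Ω : Set (EuclideanSpace ℝ (Fin N))} {a A : EuclideanSpace ℝ (Fin N) → ℝ}
  {R β c t₀ σ η ν κ K m M : ℝ} {W : EuclideanSpace ℝ (Fin N) × ℝ → ℝ}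

/-- The pointwise size of the initial data, with `k + 1` derivatives of the position and `k`
derivatives of the velocity. -/
noncomputable def dataSize (k : ℕ) (W : EuclideanSpace ℝ (Fin N) × ℝ → ℝ)
    (x : EuclideanSpace ℝ (Fin N)) : ℝ :=
  (∑ i ∈ Finset.range (k + 2), ‖iteratedFDeriv ℝ i (fun y => W (y, 0)) x‖) +
    ∑ i ∈ Finset.range (k + 1), ‖iteratedFDeriv ℝ i (fun y => timeDeriv W (y, 0)) x‖

lemma dataSize_nonneg (k : ℕ) (W : EuclideanSpace ℝ (Fin N) × ℝ → ℝ)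
    (x : EuclideanSpace ℝ (Fin N)) : 0 ≤ dataSize k W x := by
  unfold dataSize
  positivity

lemma contDiff_slice {U : EuclideanSpace ℝ (Fin N) × ℝ → ℝ} (hU : ContDiff ℝ (⊤ : ℕ∞) U)
    (s : ℝ) : ContDiff ℝ (⊤ : ℕ∞) fun y => U (y, s) :=
  hU.comp (contDiff_id.prodMk contDiff_const)

/-- Through the equation, the initial values of the time derivatives of a damped wave are
controlled by the initial data. -/
lemma exists_iteratedFDeriv_timeDeriv_le (hΩ : IsOpen Ω) {k : ℕ} (ha : ContDiff ℝ k a) (R : ℝ)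
    (j : ℕ) : ∃ C, 0 ≤ C ∧ ∀ W, IsDampedWave Ω a R W → ∀ x ∈ Ω, ‖x‖ ≤ R → ∀ n, n + j ≤ k + 1 →
      ‖iteratedFDeriv ℝ n (fun y => timeDeriv^[j] W (y, 0)) x‖ ≤ C * dataSize k W x := by
  obtain ⟨B, hB0, hB⟩ : ∃ B, 0 ≤ B ∧ ∀ l ≤ k, ∀ x : EuclideanSpace ℝ (Fin N), ‖x‖ ≤ R →
      ‖iteratedFDeriv ℝ l a x‖ ≤ B := by
    have h1 : ∀ l : ℕ, ∃ B, l ≤ k → ∀ x : EuclideanSpace ℝ (Fin N), ‖x‖ ≤ R →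
        ‖iteratedFDeriv ℝ l a x‖ ≤ B := by
      intro l
      by_cases hl : l ≤ k
      · obtain ⟨B, hB⟩ := (isCompact_closedBall (0 : EuclideanSpace ℝ (Fin N))
          R).exists_bound_of_continuousOn
          (ha.continuous_iteratedFDeriv (by exact_mod_cast hl)).continuousOn
        exact ⟨B, fun _ x hx => hB x (by simpa using hx)⟩
      · exact ⟨0, fun h => absurd h hl⟩
    choose B hB using h1
    refine ⟨∑ l ∈ Finset.range (k + 1), |B l|, by positivity, fun l hl x hx => ?_⟩
    exact ((hB l hl x hx).trans (le_abs_self _)).trans (Finset.single_le_sum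
      (f := fun l => |B l|) (fun _ _ => abs_nonneg _) (Finset.mem_range.2 (by omega)))
  induction j using Nat.twoStepInduction with
  | zero =>
    refine ⟨1, zero_le_one, fun W _ x _ _ n hn => ?_⟩
    rw [one_mul]
    refine (Finset.single_le_sum (f := fun n => ‖iteratedFDeriv ℝ n (fun y => W (y, 0)) x‖)
      (fun _ _ => norm_nonneg _) (Finset.mem_range.2 (by omega : n < k + 2))).trans ?_
    exact le_add_of_nonneg_right (by positivity)
  | one =>
    refine ⟨1, zero_le_one, fun W _ x _ _ n hn => ?_⟩
    rw [one_mul]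
    refine (Finset.single_le_sum
      (f := fun n => ‖iteratedFDeriv ℝ n (fun y => timeDeriv W (y, 0)) x‖)
      (fun _ _ => norm_nonneg _) (Finset.mem_range.2 (by omega : n < k + 1))).trans ?_
    exact le_add_of_nonneg_left (by positivity)
  | more j ih0 ih1 =>
    obtain ⟨C0, hC0, h0⟩ := ih0
    obtain ⟨C1, hC1, h1⟩ := ih1
    refine ⟨N * C0 + 2 ^ (k + 1) * B * C1, by positivity, fun W hW x hx hxR n hn => ?_⟩
    have hWj := hW.iterate_timeDeriv j
    have hWj1 := hW.iterate_timeDeriv (j + 1)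
    have hf := contDiff_slice hWj.smooth 0
    have hg := contDiff_slice hWj1.smooth 0
    have hdd : ∀ i : Fin N, ContDiff ℝ (⊤ : ℕ∞) fun y => fderiv ℝ (fun y =>
        timeDeriv^[j] W (y, 0)) y (EuclideanSpace.single i 1) := fun i =>
      (hf.fderiv_right (m := ((⊤ : ℕ∞) : WithTop ℕ∞)) (by simp)).clm_apply contDiff_const
    have hdd2 : ∀ i : Fin N, ContDiff ℝ (⊤ : ℕ∞) fun y => fderiv ℝ (fun y => fderiv ℝ (fun y =>
        timeDeriv^[j] W (y, 0)) y (EuclideanSpace.single i 1)) y (EuclideanSpace.single i 1) :=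
      fun i => ((hdd i).fderiv_right (m := ((⊤ : ℕ∞) : WithTop ℕ∞)) (by simp)).clm_apply
        contDiff_const
    have heq : (fun y => timeDeriv^[j + 2] W (y, 0)) =ᶠ[𝓝 x]
        (fun y => ∑ i, fderiv ℝ (fun y => fderiv ℝ (fun y => timeDeriv^[j] W (y, 0)) y
          (EuclideanSpace.single i 1)) y (EuclideanSpace.single i 1)) -
        fun y => a y * timeDeriv^[j + 1] W (y, 0) := by
      filter_upwards [hΩ.mem_nhds hx] with y hy
      rw [Function.iterate_succ_apply', Function.iterate_succ_apply', hWj.eqn_zero hy]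
      rw [← lap_space hWj.smooth, Pi.sub_apply]
      rfl
    rw [(Filter.EventuallyEq.iteratedFDeriv ℝ heq n).eq_of_nhds]
    have hnk : n ≤ k := by omega
    have han : ContDiff ℝ n a := ha.of_le (by exact_mod_cast hnk)
    have htop : ((n : ℕ∞) : WithTop ℕ∞) ≤ ((⊤ : ℕ∞) : WithTop ℕ∞) :=
      WithTop.coe_le_coe.2 le_top
    have hgn : ContDiff ℝ n fun y => timeDeriv^[j + 1] W (y, 0) := hg.of_le htop
    have hdn : ∀ i : Fin N, ContDiff ℝ n _ := fun i => (hdd2 i).of_le htop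
    rw [iteratedFDeriv_sub_apply (ContDiff.sum fun i _ => hdn i).contDiffAt
      (han.mul hgn).contDiffAt, iteratedFDeriv_fun_sum_apply fun i _ => (hdn i).contDiffAt]
    have hD := dataSize_nonneg k W x
    have e1 : ‖∑ i : Fin N, iteratedFDeriv ℝ n (fun y => fderiv ℝ (fun y => fderiv ℝ (fun y =>
        timeDeriv^[j] W (y, 0)) y (EuclideanSpace.single i 1)) y
        (EuclideanSpace.single i 1)) x‖ ≤ N * C0 * dataSize k W x := by
      refine (norm_sum_le _ _).trans ?_
      have : ∀ i : Fin N, ‖iteratedFDeriv ℝ n (fun y => fderiv ℝ (fun y => fderiv ℝ (fun y =>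
          timeDeriv^[j] W (y, 0)) y (EuclideanSpace.single i 1)) y
          (EuclideanSpace.single i 1)) x‖ ≤ C0 * dataSize k W x := by
        intro i
        have h2 := norm_iteratedFDeriv_fderiv_apply_le (hdd i) n (EuclideanSpace.single i 1) x
        have h3 := norm_iteratedFDeriv_fderiv_apply_le hf (n + 1) (EuclideanSpace.single i 1) x
        simp only [PiLp.norm_single, norm_one, one_mul] at h2 h3
        exact h2.trans (h3.trans (h0 W hW x hx hxR (n + 1 + 1) (by omega)))
      refine (Finset.sum_le_sum fun i _ => this i).trans ?_
      simp [mul_assoc]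
    have e2 : ‖iteratedFDeriv ℝ n (fun y => a y * timeDeriv^[j + 1] W (y, 0)) x‖ ≤
        2 ^ (k + 1) * B * C1 * dataSize k W x := by
      refine (norm_iteratedFDeriv_mul_le han hgn x le_rfl).trans ?_
      calc _ ≤ ∑ l ∈ Finset.range (n + 1), (n.choose l : ℝ) * (B * (C1 * dataSize k W x)) := by
            refine Finset.sum_le_sum fun l hl => ?_
            rw [Finset.mem_range] at hl
            rw [mul_assoc]
            gcongr
            · exact hB l (by omega) x hxR
            · exact h1 W hW x hx hxR (n - l) (by omega)
        _ = 2 ^ n * (B * (C1 * dataSize k W x)) := by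
            rw [← Finset.sum_mul]
            congr 1
            exact_mod_cast Nat.sum_range_choose n
        _ ≤ 2 ^ (k + 1) * (B * (C1 * dataSize k W x)) := by
            gcongr
            · norm_num
            · omega
        _ = _ := by ring
    refine (norm_sub_le _ _).trans ((add_le_add e1 e2).trans (le_of_eq (by ring)))

end InitialData

section InitialEnergy

variable {N : ℕ} {Ω : Set (EuclideanSpace ℝ (Fin N))} {a A : EuclideanSpace ℝ (Fin N) → ℝ}
  {R β c t₀ σ η ν κ K m M : ℝ} {W : EuclideanSpace ℝ (Fin N) × ℝ → ℝ}

lemma dataSize_sq_le (k : ℕ) (W : EuclideanSpace ℝ (Fin N) × ℝ → ℝ)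
    (x : EuclideanSpace ℝ (Fin N)) : dataSize k W x ^ 2 ≤ 2 * (k + 2) *
      ((∑ i ∈ Finset.range (k + 2), ‖iteratedFDeriv ℝ i (fun y => W (y, 0)) x‖ ^ 2) +
        ∑ i ∈ Finset.range (k + 1), ‖iteratedFDeriv ℝ i (fun y => timeDeriv W (y, 0)) x‖ ^ 2) := by
  have h1 := sq_sum_le_card_mul_sum_sq (s := Finset.range (k + 2))
    (f := fun i => ‖iteratedFDeriv ℝ i (fun y => W (y, 0)) x‖)
  have h2 := sq_sum_le_card_mul_sum_sq (s := Finset.range (k + 1))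
    (f := fun i => ‖iteratedFDeriv ℝ i (fun y => timeDeriv W (y, 0)) x‖)
  simp only [Finset.card_range] at h1 h2
  push_cast at h1 h2
  have h3 : 0 ≤ ∑ i ∈ Finset.range (k + 1),
    ‖iteratedFDeriv ℝ i (fun y => timeDeriv W (y, 0)) x‖ ^ 2 := by positivity
  unfold dataSize
  refine (add_sq_le).trans ?_
  linarith

lemma exists_energyDensity_zero_le (hΩ : IsOpen Ω) {k : ℕ} (ha : ContDiff ℝ k a)
    (hw : EnergyWeight a A R β c t₀ σ η ν κ K m M) :
    ∃ C, 0 ≤ C ∧ ∀ W, IsDampedWave Ω a R W → ∀ j ≤ k, ∀ x ∈ Ω,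
      energyDensity a A β c t₀ σ (timeDeriv^[j] W) x 0 ≤ C * dataSize k W x ^ 2 := by
  choose B hB0 hB using exists_iteratedFDeriv_timeDeriv_le (a := a) hΩ ha R
  set C := ∑ j ∈ Finset.range (k + 2), B j with hC_def
  have hC0 : 0 ≤ C := Finset.sum_nonneg fun j _ => hB0 j
  have hBC : ∀ j ≤ k + 1, B j ≤ C := fun j hj =>
    Finset.single_le_sum (fun j _ => hB0 j) (Finset.mem_range.2 (by omega))
  have hbound : ∀ {f : EuclideanSpace ℝ (Fin N) → ℝ}, Continuous f →
      ∃ b, 0 ≤ b ∧ ∀ x, ‖x‖ ≤ R → f x ≤ b := by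
    intro f hf
    obtain ⟨b, hb⟩ := (isCompact_closedBall (0 : EuclideanSpace ℝ (Fin N))
      R).exists_bound_of_continuousOn hf.continuousOn
    exact ⟨max b 0, le_max_right _ _, fun x hx =>
      ((le_abs_self _).trans (hb x (by simpa using hx))).trans (le_max_left _ _)⟩
  obtain ⟨b₁, hb₁, hΦ⟩ := hbound (continuous_expWeight hw 0)
  obtain ⟨b₂, hb₂, ha'⟩ := hbound hw.cont
  have hσ := hw.sigma_pos
  have ht₀ : 0 < t₀ := by linarith [hw.one_le_t₀]
  refine ⟨b₁ * (2 + b₂ + σ * t₀ * (N + 1)) * C ^ 2, by positivity, fun W hW j hj x hx => ?_⟩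
  have hWj := hW.iterate_timeDeriv j
  rcases le_or_gt ‖x‖ R with hxR | hxR
  · have hD := dataSize_nonneg k W x
    have bd : ∀ j ≤ k + 1, ∀ n, n + j ≤ k + 1 →
        ‖iteratedFDeriv ℝ n (fun y => timeDeriv^[j] W (y, 0)) x‖ ≤ C * dataSize k W x :=
      fun j hj n hn => (hB j W hW x hx hxR n hn).trans
        (mul_le_mul_of_nonneg_right (hBC j hj) hD)
    have h1 := bd j (by omega) 0 (by omega)
    have h2 := bd (j + 1) (by omega) 0 (by omega)
    have h3 : ∀ i, |spaceDeriv i (timeDeriv^[j] W) (x, 0)| ≤ C * dataSize k W x := by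
      intro i
      refine le_trans ?_ (bd j (by omega) 1 (by omega))
      rw [← fderiv_space ((hWj.smooth.differentiable (by simp)) _),
        ← norm_iteratedFDeriv_fderiv, norm_iteratedFDeriv_zero]
      simpa using (fderiv ℝ (fun y => timeDeriv^[j] W (y, 0)) x).le_opNorm
        (EuclideanSpace.single i (1 : ℝ))
    simp only [norm_iteratedFDeriv_zero, Real.norm_eq_abs, Function.iterate_succ_apply'] at h1 h2
    set d := C * dataSize k W x with hd_def
    have hsq : ∀ {y : ℝ}, |y| ≤ d → y ^ 2 ≤ d ^ 2 := fun {y} hy => by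
      rw [← sq_abs]; gcongr
    have h4 : ∑ i, spaceDeriv i (timeDeriv^[j] W) (x, 0) ^ 2 ≤ N * d ^ 2 := by
      refine (Finset.sum_le_sum fun i _ => hsq (h3 i)).trans ?_
      simp
    have h5 := hsq h1
    have h6 := hsq h2
    have h7 : a x * timeDeriv^[j] W (x, 0) ^ 2 ≤ b₂ * d ^ 2 := by
      have := ha' x hxR
      gcongr
    have h8 : 2 * timeDeriv^[j] W (x, 0) * timeDeriv (timeDeriv^[j] W) (x, 0) ≤ 2 * d ^ 2 := by
      linarith [two_mul_le_add_sq (timeDeriv^[j] W (x, 0)) (timeDeriv (timeDeriv^[j] W) (x, 0))]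
    have h9 : σ * (t₀ + 0) * ((∑ i, spaceDeriv i (timeDeriv^[j] W) (x, 0) ^ 2) +
        timeDeriv (timeDeriv^[j] W) (x, 0) ^ 2) ≤ σ * t₀ * ((N + 1) * d ^ 2) := by
      rw [add_zero]
      gcongr
      linarith
    calc energyDensity a A β c t₀ σ (timeDeriv^[j] W) x 0
        ≤ expWeight A β c x 0 * ((2 + b₂ + σ * t₀ * (N + 1)) * d ^ 2) :=
          mul_le_mul_of_nonneg_left (by linarith) (expWeight_pos x 0).le
      _ ≤ b₁ * ((2 + b₂ + σ * t₀ * (N + 1)) * d ^ 2) := by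
          gcongr
          exact hΦ x hxR
      _ = _ := by rw [hd_def]; ring
  · have hx0 : R + 0 < ‖x‖ := by simpa using hxR
    have h1 := hWj.supp_zero le_rfl hx0
    have h2 := hWj.timeDeriv.supp_zero le_rfl hx0
    have h3 := hWj.spaceDeriv_supp le_rfl hx0
    have : energyDensity a A β c t₀ σ (timeDeriv^[j] W) x 0 = 0 := by
      simp [energyDensity, h1, h2, h3]
    rw [this]
    positivity

/-- The initial energies are controlled by Sobolev norms of the initial data. -/
lemma exists_setIntegral_energyDensity_zero_le (hΩ : IsOpen Ω) {k : ℕ} (ha : ContDiff ℝ k a)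
    (hw : EnergyWeight a A R β c t₀ σ η ν κ K m M) :
    ∃ C, 0 ≤ C ∧ ∀ W, IsDampedWave Ω a R W → ∀ j ≤ k, ∀ r : ℝ,
      ∫ x in Ω ∩ Metric.closedBall 0 r, energyDensity a A β c t₀ σ (timeDeriv^[j] W) x 0 ≤
      C * ((∑ i ∈ Finset.range (k + 2), ∫ x in Ω, ‖iteratedFDeriv ℝ i (fun y => W (y, 0)) x‖ ^ 2) +
        ∑ i ∈ Finset.range (k + 1),
          ∫ x in Ω, ‖iteratedFDeriv ℝ i (fun y => timeDeriv W (y, 0)) x‖ ^ 2) := by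
  obtain ⟨C, hC, hle⟩ := exists_energyDensity_zero_le hΩ ha hw
  refine ⟨C * (2 * (k + 2)), by positivity, fun W hW j hj r => ?_⟩
  have hint : ∀ {U : EuclideanSpace ℝ (Fin N) × ℝ → ℝ}, IsDampedWave Ω a R U → ∀ i : ℕ,
      Integrable fun x => ‖iteratedFDeriv ℝ i (fun y => U (y, 0)) x‖ ^ 2 := by
    intro U hU i
    have hcs : HasCompactSupport fun y => U (y, 0) := by
      refine HasCompactSupport.of_support_subset_isCompact (isCompact_closedBall 0 R)
        fun x hx => ?_
      by_contra hx'
      exact hx (hU.supp_zero le_rfl (by simpa using hx'))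
    refine Continuous.integrable_of_hasCompactSupport ?_ ?_
    · exact ((contDiff_slice hU.smooth 0).continuous_iteratedFDeriv
        (WithTop.coe_le_coe.2 (le_top (a := (i : ℕ∞))))).norm.pow 2
    · exact (hcs.iteratedFDeriv i).comp_left (g := fun z => ‖z‖ ^ 2) (by simp)
  have h1 := fun i => hint hW i
  have h2 := fun i => hint hW.timeDeriv i
  have hI := (integrable_finsetSum (Finset.range (k + 2)) fun i _ => h1 i).add
    (integrable_finsetSum (Finset.range (k + 1)) fun i _ => h2 i)
  rw [← integral_finsetSum _ fun i _ => (h1 i).integrableOn,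
    ← integral_finsetSum _ fun i _ => (h2 i).integrableOn,
    ← integral_add (integrable_finsetSum _ fun i _ => (h1 i).integrableOn)
      (integrable_finsetSum _ fun i _ => (h2 i).integrableOn), ← integral_const_mul]
  refine (setIntegral_mono_on ((continuous_energyDensity hw (hW.iterate_timeDeriv j)
    le_rfl).integrableOn_of_subset_closedBall inter_subset_right)
    (hI.const_mul (C * (2 * (k + 2)))).integrableOn
    (hΩ.measurableSet.inter Metric.isClosed_closedBall.measurableSet) fun x hx => ?_).trans
    (setIntegral_mono_set (hI.const_mul _).integrableOn ?_
      (Eventually.of_forall inter_subset_left))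
  · refine (hle W hW j hj x hx.1).trans ?_
    have := mul_le_mul_of_nonneg_left (dataSize_sq_le k W x) hC
    exact this.trans (le_of_eq (mul_assoc _ _ _).symm)
  · refine Eventually.of_forall fun x => ?_
    simp only [Pi.zero_apply, Pi.add_apply]
    positivity

end InitialEnergy

section Decay

variable {N : ℕ} {Ω : Set (EuclideanSpace ℝ (Fin N))} {a A : EuclideanSpace ℝ (Fin N) → ℝ}
  {R β c t₀ σ η ν κ K m : ℝ}

/-- Weighted decay estimates for damped waves in terms of Sobolev norms of the initial data. -/
lemma exists_weighted_decay (hΩ : IsOpen Ω) {k : ℕ} (ha : ContDiff ℝ k a)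
    (hw : EnergyWeight a A R β c t₀ σ η ν κ K m (m + 2 * k)) :
    ∃ C > (0 : ℝ), ∀ W, IsDampedWave Ω a R W → ∀ t ≥ (0 : ℝ),
      (∫ x in Ω, expWeight A β c x t * (a x * timeDeriv^[k] W (x, t) ^ 2)) ≤
        C * (t₀ + t) ^ (-(m + 2 * k)) *
        ((∑ i ∈ Finset.range (k + 2), ∫ x in Ω, ‖iteratedFDeriv ℝ i (fun y => W (y, 0)) x‖ ^ 2) +
        ∑ i ∈ Finset.range (k + 1),
          ∫ x in Ω, ‖iteratedFDeriv ℝ i (fun y => timeDeriv W (y, 0)) x‖ ^ 2) ∧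
      (∫ x in Ω, expWeight A β c x t * ∑ i, spaceDeriv i (timeDeriv^[k] W) (x, t) ^ 2) ≤
        C * (t₀ + t) ^ (-(m + 2 * k) - 1) *
        ((∑ i ∈ Finset.range (k + 2), ∫ x in Ω, ‖iteratedFDeriv ℝ i (fun y => W (y, 0)) x‖ ^ 2) +
        ∑ i ∈ Finset.range (k + 1),
          ∫ x in Ω, ‖iteratedFDeriv ℝ i (fun y => timeDeriv W (y, 0)) x‖ ^ 2) := by
  obtain ⟨C₀, hC₀, hinit⟩ := exists_setIntegral_energyDensity_zero_le hΩ ha hw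
  have hσ := hw.sigma_pos
  have hμ : 0 < σ / (4 * (k + 1)) := by positivity
  have hμσ : σ / (4 * (k + 1)) * (2 * (k + 1)) ≤ σ / 2 := by
    refine le_of_eq ?_
    field_simp
    norm_num
  set μ := σ / (4 * (k + 1))
  have ht₀ : 0 < t₀ := by linarith [hw.one_le_t₀]
  set C₁ := ∑ j ∈ Finset.range (k + 1), μ ^ j * (t₀ ^ (m + 2 * j : ℝ) * C₀) with hC₁_def
  have hC₁ : 0 ≤ C₁ := Finset.sum_nonneg fun j _ => by positivity
  refine ⟨2 * C₁ / μ ^ k + 2 * C₁ / (σ * μ ^ k) + 1, by positivity, fun W hW t ht => ?_⟩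
  have hWk := hW.iterate_timeDeriv k
  have hT : 0 < t₀ + t := by linarith
  set D := (∑ i ∈ Finset.range (k + 2), ∫ x in Ω, ‖iteratedFDeriv ℝ i (fun y => W (y, 0)) x‖ ^ 2) +
        ∑ i ∈ Finset.range (k + 1),
          ∫ x in Ω, ‖iteratedFDeriv ℝ i (fun y => timeDeriv W (y, 0)) x‖ ^ 2 with hD_def
  have hD : 0 ≤ D := by positivity
  have key := energy_decay hΩ hw hW hμ hμσ ht
  have hsum : ∑ j ∈ Finset.range (k + 1), μ ^ j * (t₀ ^ (m + 2 * j : ℝ) *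
      ∫ x in Ω ∩ Metric.closedBall 0 (R + t),
        energyDensity a A β c t₀ σ (timeDeriv^[j] W) x 0) ≤ C₁ * D := by
    rw [hC₁_def, Finset.sum_mul]
    refine Finset.sum_le_sum fun j hj => ?_
    rw [mul_assoc, mul_assoc]
    have := hinit W hW j (by simpa [Nat.lt_succ_iff] using hj) (R + t)
    gcongr
  have hout : ∀ {x}, x ∈ Ω \ (Ω ∩ Metric.closedBall 0 (R + t)) → R + t < ‖x‖ := by
    intro x hx
    by_contra hle
    exact hx.2 ⟨hx.1, by simpa using hle⟩
  rw [← setIntegral_eq_of_subset_of_forall_sdiff_eq_zero hΩ.measurableSet inter_subset_left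
      fun x hx => by rw [hWk.supp_zero ht (hout hx)]; ring,
    ← setIntegral_eq_of_subset_of_forall_sdiff_eq_zero hΩ.measurableSet inter_subset_left
      fun x hx => by simp [hWk.spaceDeriv_supp ht (hout hx)]] at key
  set I := ∫ x in Ω, expWeight A β c x t * (a x * timeDeriv^[k] W (x, t) ^ 2)
  set J := ∫ x in Ω, expWeight A β c x t * ∑ i, spaceDeriv i (timeDeriv^[k] W) (x, t) ^ 2
  have hI : 0 ≤ I := integral_nonneg fun x =>
    mul_nonneg (expWeight_pos x t).le (mul_nonneg (hw.pos x).le (sq_nonneg _))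
  have hJ : 0 ≤ J := integral_nonneg fun x => mul_nonneg (expWeight_pos x t).le
    (Finset.sum_nonneg fun _ _ => sq_nonneg _)
  have hTp : 0 < (t₀ + t) ^ (m + 2 * k : ℝ) := by positivity
  have hdiv : 1 / 2 * I + σ / 2 * (t₀ + t) * J ≤
      C₁ * D / μ ^ k * (t₀ + t) ^ (-(m + 2 * k) : ℝ) := by
    rw [rpow_neg hT.le, ← div_eq_mul_inv, div_div, le_div_iff₀ (by positivity)]
    linarith [key.trans hsum]
  have hJ' : 0 ≤ σ / 2 * (t₀ + t) * J := by positivity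
  constructor
  · calc I ≤ 2 * C₁ / μ ^ k * (t₀ + t) ^ (-(m + 2 * k) : ℝ) * D := by
          have : 2 * C₁ / μ ^ k * (t₀ + t) ^ (-(m + 2 * k) : ℝ) * D =
            2 * (C₁ * D / μ ^ k * (t₀ + t) ^ (-(m + 2 * k) : ℝ)) := by ring
          linarith
      _ ≤ _ := by
          gcongr
          have : 0 ≤ 2 * C₁ / (σ * μ ^ k) := by positivity
          linarith
  · calc J ≤ 2 * C₁ / (σ * μ ^ k) * (t₀ + t) ^ (-(m + 2 * k) - 1 : ℝ) * D := by
          have h1 : σ / 2 * (t₀ + t) * J ≤ C₁ * D / μ ^ k * (t₀ + t) ^ (-(m + 2 * k) : ℝ) := by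
            linarith
          have h2 : 2 * C₁ / (σ * μ ^ k) * (t₀ + t) ^ (-(m + 2 * k) - 1 : ℝ) * D =
              C₁ * D / μ ^ k * (t₀ + t) ^ (-(m + 2 * k) : ℝ) / (σ / 2 * (t₀ + t)) := by
            rw [rpow_sub_one hT.ne']
            field_simp
          rw [h2, le_div_iff₀ (by positivity)]
          linarith
      _ ≤ _ := by
          gcongr
          have : 0 ≤ 2 * C₁ / μ ^ k := by positivity
          linarith

end Decay

end

/-- **Proposition 3.2 (weighted energy estimates).** Under the stated assumptions on
`a`, `A` and `h`, for every `ε > 0` and `k ∈ ℕ` there are `β > 0`, `c₀ ≥ 0`,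
`t₀ > 0` and `C > 0` such that every smooth solution of the damped wave equation
with data supported in `{|x| < R₀}` satisfies, with `Ã = A + c₀`,
`∫_Ω Φ_{Ã,β} a |∂_t^k u|² dx ≤ C (t₀+t)^{-1/h-2k+ε} ‖(u₀,u₁)‖²_{H^{k+1}×H^k}` and
`∫_Ω Φ_{Ã,β} |∇∂_t^k u|² dx ≤ C (t₀+t)^{-1/h-2k-1+ε} ‖(u₀,u₁)‖²_{H^{k+1}×H^k}`. -/
theorem stmt12 (N : ℕ) (hN : 2 ≤ N) (Ω : Set (EuclideanSpace ℝ (Fin N)))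
    (hΩopen : IsOpen Ω) (hΩconn : IsConnected Ω) (hΩcompl : IsCompact Ωᶜ)
    (hΩ0 : (0 : EuclideanSpace ℝ (Fin N)) ∉ closure Ω)
    (a : EuclideanSpace ℝ (Fin N) → ℝ) (ha2 : ContDiff ℝ 2 a) (ha_pos : ∀ x, 0 < a x)
    (ha_rad : ∀ x y : EuclideanSpace ℝ (Fin N), ‖x‖ = ‖y‖ → a x = a y)
    (a₁ a₂ α : ℝ) (ha₁ : 0 < a₁) (ha₂ : 0 < a₂) (hα : 0 ≤ α ∧ α < 1)
    (ha_bd : ∀ x : EuclideanSpace ℝ (Fin N),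
      a₁ * (1 + ‖x‖) ^ (-α) ≤ a x ∧ a x ≤ a₂ * (1 + ‖x‖) ^ (-α))
    (A : EuclideanSpace ℝ (Fin N) → ℝ) (hA : ContDiff ℝ 2 A)
    (hPoisson : ∀ x, lap A x = a x)
    (A₁ A₂ : ℝ) (hA₁ : 0 < A₁) (hA₂ : 0 < A₂)
    (hA_bd : ∀ x : EuclideanSpace ℝ (Fin N),
      A₁ * (1 + ‖x‖) ^ (2 - α) ≤ A x ∧ A x ≤ A₂ * (1 + ‖x‖) ^ (2 - α))
    (h : ℝ) (hh : 0 < h)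
    (hgrad : ∀ δ > (0 : ℝ), ∃ R > (0 : ℝ), ∀ x : EuclideanSpace ℝ (Fin N), R ≤ ‖x‖ →
      ‖gradient A x‖ ^ 2 ≤ (h + δ) * a x * A x)
    (R₀ : ℝ) (hR₀ : 0 < R₀) :
    ∀ ε > (0 : ℝ), ∀ k : ℕ, ContDiff ℝ (max k 2 : ℕ) a →
    ∃ β > (0 : ℝ), ∃ c₀ ≥ (0 : ℝ), ∃ t₀ > (0 : ℝ), ∃ C > (0 : ℝ),
      ∀ u : EuclideanSpace ℝ (Fin N) → ℝ → ℝ,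
        ContDiff ℝ (⊤ : ℕ∞) (fun p : EuclideanSpace ℝ (Fin N) × ℝ => u p.1 p.2) →
        (∀ x ∈ Ω, ∀ s > (0 : ℝ),
          deriv (deriv (u x)) s - lap (fun y => u y s) x + a x * deriv (u x) s = 0) →
        (∀ x ∈ frontier Ω, ∀ s > (0 : ℝ), u x s = 0) →
        (∀ x : EuclideanSpace ℝ (Fin N), R₀ ≤ ‖x‖ → u x 0 = 0 ∧ deriv (u x) 0 = 0) →
        (∀ s ≥ (0 : ℝ), ∀ x : EuclideanSpace ℝ (Fin N), R₀ + s < ‖x‖ → u x s = 0) →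
      ∀ t ≥ (0 : ℝ),
        (∫ x in Ω, Real.exp (β * (A x + c₀) / (1 + t)) * a x
            * (deriv^[k] (u x) t) ^ 2)
          ≤ C * (t₀ + t) ^ (-(1 / h) - 2 * (k : ℝ) + ε) *
            ((∑ j ∈ Finset.range (k + 2),
                ∫ x in Ω, ‖iteratedFDeriv ℝ j (fun y => u y 0) x‖ ^ 2)
              + ∑ j ∈ Finset.range (k + 1),
                  ∫ x in Ω, ‖iteratedFDeriv ℝ j (fun y => deriv (u y) 0) x‖ ^ 2)
        ∧
        (∫ x in Ω, Real.exp (β * (A x + c₀) / (1 + t))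
            * ‖gradient (fun y => deriv^[k] (u y) t) x‖ ^ 2)
          ≤ C * (t₀ + t) ^ (-(1 / h) - 2 * (k : ℝ) - 1 + ε) *
            ((∑ j ∈ Finset.range (k + 2),
                ∫ x in Ω, ‖iteratedFDeriv ℝ j (fun y => u y 0) x‖ ^ 2)
              + ∑ j ∈ Finset.range (k + 1),
                  ∫ x in Ω, ‖iteratedFDeriv ℝ j (fun y => deriv (u y) 0) x‖ ^ 2) := by
  intro ε hε k hak
  set m : ℝ := 1 / h - min ε (1 / (2 * h)) with hm_def
  have hmin : 0 < min ε (1 / (2 * h)) := lt_min hε (by positivity)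
  have hm : 0 < m := by
    have h1 : min ε (1 / (2 * h)) ≤ 1 / (2 * h) := min_le_right _ _
    have h2 : 1 / (2 * h) < 1 / h := one_div_lt_one_div_of_lt hh (by linarith)
    linarith
  have hmε : 1 / h - ε ≤ m := by linarith [min_le_left ε (1 / (2 * h))]
  have hk : (0 : ℝ) ≤ 2 * k := by positivity
  obtain ⟨β, c, t₀, σ, η, ν, κ, K, hc, hw⟩ := exists_energyWeight ha2.continuous ha_pos ha₁ hα.1
    hα.2 (fun x => (ha_bd x).1) hA hPoisson
    (fun x => le_trans (by positivity) (hA_bd x).1) (fun x => (hA_bd x).2) hh hgrad hR₀ hm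
    (by linarith : m < 1 / h) (by linarith : m ≤ m + 2 * k)
  obtain ⟨C, hC, hdecay⟩ := exists_weighted_decay hΩopen
    (hak.of_le (by exact_mod_cast le_max_left k 2)) hw
  have ht₀ := hw.one_le_t₀
  refine ⟨β, hw.beta_pos, c, hc, t₀, by linarith, C, hC,
    fun u hu heqn hbd _ hsupp t ht => ?_⟩
  have hder : ∀ x j s, deriv^[j] (u x) s =
      timeDeriv^[j] (fun p : EuclideanSpace ℝ (Fin N) × ℝ => u p.1 p.2) (x, s) :=
    fun x j s => congrFun (deriv_iterate_time hu x j).2 s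
  have hW : IsDampedWave Ω a R₀ (fun p : EuclideanSpace ℝ (Fin N) × ℝ => u p.1 p.2) := by
    refine ⟨hu, fun x hx s hs => ?_, hbd, fun s hs x hx => hsupp s hs.le x hx⟩
    have h0 := heqn x hx s hs
    have h1 := hder x 1 s
    have h2 := hder x 2 s
    have h3 := lap_space hu x s
    simp only [Function.iterate_succ, Function.iterate_zero, Function.comp_apply, id_eq] at h1 h2
    rw [h1, h2] at h0
    linarith
  have hWk := hW.iterate_timeDeriv k
  obtain ⟨h1, h2⟩ := hdecay _ hW t ht
  have hgr : ∀ x, ‖gradient (fun y => deriv^[k] (u y) t) x‖ ^ 2 = ∑ i, spaceDeriv i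
      (timeDeriv^[k] (fun p : EuclideanSpace ℝ (Fin N) × ℝ => u p.1 p.2)) (x, t) ^ 2 := by
    intro x
    simp only [sum_sq_eq_norm_gradient_sq, hder]
    exact Finset.sum_congr rfl fun i _ => by
      rw [fderiv_space ((hWk.smooth.differentiable (by simp)) _)]
  have hdata : ∀ y, deriv (u y) 0 =
      timeDeriv (fun p : EuclideanSpace ℝ (Fin N) × ℝ => u p.1 p.2) (y, 0) :=
    fun y => hder y 1 0
  simp only [hgr, hdata, mul_assoc (Real.exp _)]
  simp only [hder]
  constructor
  · refine h1.trans ?_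
    gcongr
    · linarith
    · linarith
  · refine h2.trans ?_
    gcongr
    · linarith
    · linarith
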